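/- Case 2 (large relay-to-terminal rates, interactive inner bound for two cascaded rounds). Suppose R_RA ≥ H(Y,Z|X) and R_RB ≥ H(X,Z|Y), and suppose there exist finite-valued random variables U₁, U₂ jointly distributed with (X,Y,Z) ~ p satisfying the Markov chains U₁ − X − (Y,Z) and U₂ − (Y,Z,U₁) − X, together with decoding functions Ψ_B and Ψ_A such that E[d_B(X, Ψ_B(Y,Z,U₁))] ≤ D_B and E[d_A(Y, Ψ_A(X,Z,U₁,U₂))] ≤ D_A. Then any rates R_AR ≥ I(X;U₁|Y,Z) and R_BR ≥ I(Y;U₂|X,Z,U₁) give a tuple (R_AR, R_RB, R_BR, R_RA, D_A, D_B) that is achievable for two cascaded rounds. -/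

import Mathlib

open scoped BigOperators

noncomputable section

namespace IRSC

attribute [local instance] Classical.propDecidable

/-- A bundled finite alphabet. -/
structure FinAlph where
  carrier : Type
  [fin : Fintype carrier]

attribute [instance] FinAlph.fin

section Basic

variable {Ω α β γ : Type*} [Fintype Ω]

/-- `μ` is a probability mass function on the finite type `Ω`. -/
def IsPMF (μ : Ω → ℝ) : Prop := (∀ ω, 0 ≤ μ ω) ∧ ∑ ω, μ ω = 1

/-- The probability that the random variable `f` takes the value `a` under `μ`. -/
def probOf (μ : Ω → ℝ) (f : Ω → α) (a : α) : ℝ := ∑ ω, if f ω = a then μ ω else 0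

/-- The expectation of the real-valued random variable `g` under `μ`. -/
def expect (μ : Ω → ℝ) (g : Ω → ℝ) : ℝ := ∑ ω, μ ω * g ω

/-- The Shannon entropy (base 2) `H(f)` of a random variable `f` under `μ`. -/
def entropy [Fintype α] (μ : Ω → ℝ) (f : Ω → α) : ℝ :=
  -∑ a, probOf μ f a * Real.logb 2 (probOf μ f a)

/-- The conditional entropy `H(f | g)` under `μ`. -/
def condEntropy [Fintype α] [Fintype β] (μ : Ω → ℝ) (f : Ω → α) (g : Ω → β) : ℝ :=
  entropy μ (fun ω => (f ω, g ω)) - entropy μ g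

/-- The conditional mutual information `I(f ; g | h)` under `μ`. -/
def condMI [Fintype α] [Fintype β] [Fintype γ]
    (μ : Ω → ℝ) (f : Ω → α) (g : Ω → β) (h : Ω → γ) : ℝ :=
  condEntropy μ f h + condEntropy μ g h - condEntropy μ (fun ω => (f ω, g ω)) h

/-- `MarkovChain μ f g h` says that `f − g − h` forms a Markov chain under `μ`, i.e.
`f` and `h` are conditionally independent given `g`. -/
def MarkovChain (μ : Ω → ℝ) (f : Ω → α) (g : Ω → β) (h : Ω → γ) : Prop :=
  ∀ a b c,
    probOf μ (fun ω => (f ω, g ω, h ω)) (a, b, c) * probOf μ g b =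
      probOf μ (fun ω => (f ω, g ω)) (a, b) * probOf μ (fun ω => (g ω, h ω)) (b, c)

end Basic

/-- The i.i.d. distribution of `n` copies of `p`. -/
def iid {W : Type*} [Fintype W] (p : W → ℝ) (n : ℕ) : (Fin n → W) → ℝ :=
  fun w => ∏ i, p (w i)

/-- The past `(x_1, …, x_{i-1})` of a sequence `x` relative to position `i`. -/
def past {n : ℕ} {α : Type*} (i : Fin n) (x : Fin n → α) : {j : Fin n // j < i} → α :=
  fun j => x j.1

/-- The future `(x_{i+1}, …, x_n)` of a sequence `x` relative to position `i`. -/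
def fut {n : ℕ} {α : Type*} (i : Fin n) (x : Fin n → α) : {j : Fin n // i < j} → α :=
  fun j => x j.1

/-- A two-cascaded-rounds code of blocklength `n`: finite message sets, encoders
`φAR, φRB, φBR, φRA` and decoders `ΨA, ΨB`. -/
structure TCRCode (𝒳 𝒴 𝒵 Xh Yh : Type*) (n : ℕ) where
  MAR : FinAlph
  MRB : FinAlph
  MBR : FinAlph
  MRA : FinAlph
  φAR : (Fin n → 𝒳) → MAR.carrier
  φRB : (Fin n → 𝒵) → MAR.carrier → MRB.carrier
  φBR : (Fin n → 𝒴) → MRB.carrier → MBR.carrier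
  φRA : (Fin n → 𝒵) → MAR.carrier → MBR.carrier → MRA.carrier
  ΨA : (Fin n → 𝒳) → MRA.carrier → Fin n → Yh
  ΨB : (Fin n → 𝒴) → MRB.carrier → Fin n → Xh

namespace TCRCode

variable {𝒳 𝒴 𝒵 Xh Yh : Type*} {n : ℕ}

/-- The message `M_AR = φ_AR(X^n)`. -/
def mAR (C : TCRCode 𝒳 𝒴 𝒵 Xh Yh n) (w : Fin n → 𝒳 × 𝒴 × 𝒵) : C.MAR.carrier :=
  C.φAR fun i => (w i).1

/-- The message `M_RB = φ_RB(Z^n, M_AR)`. -/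
def mRB (C : TCRCode 𝒳 𝒴 𝒵 Xh Yh n) (w : Fin n → 𝒳 × 𝒴 × 𝒵) : C.MRB.carrier :=
  C.φRB (fun i => (w i).2.2) (C.mAR w)

/-- The message `M_BR = φ_BR(Y^n, M_RB)`. -/
def mBR (C : TCRCode 𝒳 𝒴 𝒵 Xh Yh n) (w : Fin n → 𝒳 × 𝒴 × 𝒵) : C.MBR.carrier :=
  C.φBR (fun i => (w i).2.1) (C.mRB w)

/-- The message `M_RA = φ_RA(Z^n, M_AR, M_BR)`. -/
def mRA (C : TCRCode 𝒳 𝒴 𝒵 Xh Yh n) (w : Fin n → 𝒳 × 𝒴 × 𝒵) : C.MRA.carrier :=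
  C.φRA (fun i => (w i).2.2) (C.mAR w) (C.mBR w)

/-- The reconstruction `Ŷ^n = Ψ_A(X^n, M_RA)`. -/
def Yhat (C : TCRCode 𝒳 𝒴 𝒵 Xh Yh n) (w : Fin n → 𝒳 × 𝒴 × 𝒵) : Fin n → Yh :=
  C.ΨA (fun i => (w i).1) (C.mRA w)

/-- The reconstruction `X̂^n = Ψ_B(Y^n, M_RB)`. -/
def Xhat (C : TCRCode 𝒳 𝒴 𝒵 Xh Yh n) (w : Fin n → 𝒳 × 𝒴 × 𝒵) : Fin n → Xh :=
  C.ΨB (fun i => (w i).2.1) (C.mRB w)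

/-- The average distortion `(1/n) ∑ᵢ E[d_A(Y_i, Ŷ_i)]` of the code. -/
def distA [Fintype 𝒳] [Fintype 𝒴] [Fintype 𝒵] (C : TCRCode 𝒳 𝒴 𝒵 Xh Yh n)
    (p : 𝒳 × 𝒴 × 𝒵 → ℝ) (dA : 𝒴 → Yh → ℝ) : ℝ :=
  (1 / n : ℝ) * ∑ i, expect (iid p n) fun w => dA (w i).2.1 (C.Yhat w i)

/-- The average distortion `(1/n) ∑ᵢ E[d_B(X_i, X̂_i)]` of the code. -/
def distB [Fintype 𝒳] [Fintype 𝒴] [Fintype 𝒵] (C : TCRCode 𝒳 𝒴 𝒵 Xh Yh n)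
    (p : 𝒳 × 𝒴 × 𝒵 → ℝ) (dB : 𝒳 → Xh → ℝ) : ℝ :=
  (1 / n : ℝ) * ∑ i, expect (iid p n) fun w => dB (w i).1 (C.Xhat w i)

end TCRCode

/-- Achievability of `(R_AR, R_RB, R_BR, R_RA, D_A, D_B)` for the two cascaded rounds scheme. -/
def TCRAchievable {𝒳 𝒴 𝒵 Xh Yh : Type*} [Fintype 𝒳] [Fintype 𝒴] [Fintype 𝒵]
    (p : 𝒳 × 𝒴 × 𝒵 → ℝ) (dA : 𝒴 → Yh → ℝ) (dB : 𝒳 → Xh → ℝ)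
    (RAR RRB RBR RRA DA DB : ℝ) : Prop :=
  ∀ ε > (0 : ℝ), ∃ N : ℕ, ∀ n ≥ N, ∃ C : TCRCode 𝒳 𝒴 𝒵 Xh Yh n,
    (Fintype.card C.MAR.carrier : ℝ) ≤ (2 : ℝ) ^ ((n : ℝ) * (RAR + ε)) ∧
    (Fintype.card C.MRB.carrier : ℝ) ≤ (2 : ℝ) ^ ((n : ℝ) * (RRB + ε)) ∧
    (Fintype.card C.MBR.carrier : ℝ) ≤ (2 : ℝ) ^ ((n : ℝ) * (RBR + ε)) ∧
    (Fintype.card C.MRA.carrier : ℝ) ≤ (2 : ℝ) ^ ((n : ℝ) * (RRA + ε)) ∧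
    C.distA p dA ≤ DA + ε ∧ C.distB p dB ≤ DB + ε



open MeasureTheory ProbabilityTheory in
lemma exp_tail (x : ℝ) (hx : 0 ≤ x) :
    expMeasure 1 (Set.Ioi x) = ENNReal.ofReal (Real.exp (-x)) := by
  have : IsProbabilityMeasure (expMeasure 1) := isProbabilityMeasure_expMeasure one_pos
  have h1 := cdf_expMeasure_eq (r := 1) one_pos x
  rw [if_pos hx, cdf_eq_real] at h1
  have h2 : (expMeasure 1).real (Set.Ioi x) = Real.exp (-x) := by
    rw [← Set.compl_Iic, probReal_compl_eq_one_sub measurableSet_Iic, h1]; simp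
  rw [← h2, ofReal_measureReal]

open MeasureTheory ProbabilityTheory in
lemma exp_laplace (s : ℝ) (hs : 0 ≤ s) :
    ENNReal.ofReal (1 / (1 + s)) ≤
      ∫⁻ t, (Set.Ioi (0:ℝ)).indicator (fun t => ENNReal.ofReal (Real.exp (-(s * t)))) t
        ∂(expMeasure 1) := by
  have h0 : (0:ℝ) < 1 + s := by linarith
  have hm : expMeasure 1 = volume.withDensity (exponentialPDF 1) := rfl
  have hmeas : Measurable (exponentialPDF 1) :=
    (measurable_exponentialPDFReal 1).ennreal_ofReal
  rw [hm, lintegral_withDensity_eq_lintegral_mul _ hmeas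
    ((by fun_prop : Measurable fun t : ℝ => ENNReal.ofReal (Real.exp (-(s * t)))).indicator
      measurableSet_Ioi)]
  have h1 : ∫⁻ t, ENNReal.ofReal (1 / (1 + s)) * exponentialPDF (1 + s) t
      = ENNReal.ofReal (1 / (1 + s)) := by
    rw [lintegral_const_mul _ (show Measurable (exponentialPDF (1 + s)) from
        (measurable_exponentialPDFReal _).ennreal_ofReal),
      lintegral_exponentialPDF_eq_one h0, mul_one]
  rw [← h1]
  apply lintegral_mono_ae
  have hne : ∀ᵐ t : ℝ, t ≠ 0 := by
    simp [ae_iff]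
  filter_upwards [hne] with t ht
  rcases lt_or_gt_of_ne ht with h | h
  · rw [exponentialPDF_of_neg h]; simp
  · rw [Pi.mul_apply, Set.indicator_of_mem (by exact h), exponentialPDF_of_nonneg h.le,
      exponentialPDF_of_nonneg h.le, ← ENNReal.ofReal_mul (by positivity),
      ← ENNReal.ofReal_mul (by positivity)]
    apply ENNReal.ofReal_le_ofReal
    rw [one_mul, one_mul, ← Real.exp_add, ← mul_assoc, one_div, inv_mul_cancel₀ h0.ne', one_mul]
    apply le_of_eq; congr 1; ring

open MeasureTheory ProbabilityTheory in
/-- The exponential race. -/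
lemma race {V : Type*} [Fintype V] [DecidableEq V] (v : V) (c : V → ℝ) (hc : ∀ v', 0 ≤ c v') :
    1 / (1 + ∑ v' ∈ Finset.univ.erase v, c v') ≤
      (Measure.pi (fun _ : V => expMeasure 1)).real
        {T | 0 < T v ∧ ∀ v', v' ≠ v → c v' * T v < T v'} := by
  have : IsProbabilityMeasure (expMeasure 1) := isProbabilityMeasure_expMeasure one_pos
  set μ := expMeasure 1 with hμ
  set G : Set (V → ℝ) := {T | 0 < T v ∧ ∀ v', v' ≠ v → c v' * T v < T v'} with hG
  have hGm : MeasurableSet G := by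
    have : G = {T | 0 < T v} ∩ ⋂ v' ∈ {v' | v' ≠ v}, {T | c v' * T v < T v'} := by
      ext T; simp [hG]
    rw [this]
    refine MeasurableSet.inter (measurableSet_lt (by fun_prop) (by fun_prop)) ?_
    refine MeasurableSet.biInter (Set.to_countable _) fun v' _ =>
      measurableSet_lt (by fun_prop) (by fun_prop)
  have hmp := measurePreserving_piEquivPiSubtypeProd (fun _ : V => μ) (fun x => x = v)
  have hmp1 := measurePreserving_piUnique (ι := {x // x = v}) (fun _ => μ)
  have e1 : (Measure.pi fun _ : V => μ) G = ((Measure.pi fun _ : {x // x = v} => μ).prod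
      (Measure.pi fun _ : {x // ¬ x = v} => μ))
      ((MeasurableEquiv.piEquivPiSubtypeProd (fun _ : V => ℝ) (fun x => x = v)).symm ⁻¹' G) := by
    convert (hmp.symm.measure_preimage hGm.nullMeasurableSet).symm
  set s := ∑ v' ∈ Finset.univ.erase v, c v' with hs
  have hs0 : 0 ≤ s := Finset.sum_nonneg fun _ _ => hc _
  have key : ENNReal.ofReal (1 / (1 + s)) ≤ (Measure.pi fun _ : V => μ) G := by
    rw [e1, Measure.prod_apply
      ((MeasurableEquiv.piEquivPiSubtypeProd (fun _ : V => ℝ) (fun x => x = v)).symm.measurable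
        hGm)]
    refine (exp_laplace s hs0).trans ?_
    rw [← hμ]
    have e2 := hmp1.lintegral_comp (f := fun t => (Set.Ioi (0:ℝ)).indicator
      (fun t => ENNReal.ofReal (Real.exp (-(s * t)))) t)
      ((by fun_prop : Measurable fun t : ℝ => ENNReal.ofReal (Real.exp (-(s * t)))).indicator
      measurableSet_Ioi)
    rw [← e2]
    apply lintegral_mono
    intro a
    change (Set.Ioi (0:ℝ)).indicator (fun t => ENNReal.ofReal (Real.exp (-(s * t))))
      (a ⟨v, rfl⟩) ≤ _
    by_cases ha : 0 < a ⟨v, rfl⟩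
    swap
    · rw [Set.indicator_of_notMem (by simpa using ha)]; exact bot_le
    rw [Set.indicator_of_mem (by exact ha)]
    have e3 : (Prod.mk a ⁻¹' ((MeasurableEquiv.piEquivPiSubtypeProd (fun _ : V => ℝ)
        (fun x => x = v)).symm ⁻¹' G)) =
        Set.pi Set.univ (fun v' : {x // ¬ x = v} => Set.Ioi (c v' * a ⟨v, rfl⟩)) := by
      ext b
      simp only [Set.mem_preimage, hG, Set.mem_ofPred_eq, Set.mem_pi, Set.mem_univ, true_implies,
        Set.mem_Ioi]
      have hb1 : ((MeasurableEquiv.piEquivPiSubtypeProd (fun _ : V => ℝ)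
        (fun x => x = v)).symm (a, b)) v = a ⟨v, rfl⟩ := by
        simp [MeasurableEquiv.piEquivPiSubtypeProd, Equiv.piEquivPiSubtypeProd]
      have hb2 : ∀ v' (h : ¬ v' = v), ((MeasurableEquiv.piEquivPiSubtypeProd (fun _ : V => ℝ)
        (fun x => x = v)).symm (a, b)) v' = b ⟨v', h⟩ := by
        intro v' h
        simp [MeasurableEquiv.piEquivPiSubtypeProd, Equiv.piEquivPiSubtypeProd, h]
      rw [hb1]
      constructor
      · rintro ⟨_, h⟩ ⟨v', hv'⟩
        have := h v' hv'
        rwa [hb2 v' hv'] at this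
      · intro h
        refine ⟨ha, fun v' hv' => ?_⟩
        rw [hb2 v' hv']
        exact h ⟨v', hv'⟩
    beta_reduce
    rw [e3, Measure.pi_pi]
    have e4 : ∀ v' : {x // ¬ x = v}, μ (Set.Ioi (c v' * a ⟨v, rfl⟩)) =
        ENNReal.ofReal (Real.exp (-(c v' * a ⟨v, rfl⟩))) := fun v' =>
      exp_tail _ (mul_nonneg (hc _) ha.le)
    rw [Finset.prod_congr rfl fun v' _ => e4 v', ← ENNReal.ofReal_prod_of_nonneg
      (fun _ _ => (Real.exp_pos _).le), ← Real.exp_sum]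
    apply ENNReal.ofReal_le_ofReal
    apply Real.exp_le_exp.2
    rw [Finset.sum_neg_distrib, ← Finset.sum_mul]
    have : ∑ i : {x // ¬ x = v}, c i = s := by
      rw [hs]
      symm
      apply Finset.sum_subtype
      intro x; simp
    rw [this]
  have := ENNReal.toReal_mono (measure_ne_top _ _) key
  rwa [ENNReal.toReal_ofReal (by positivity)] at this


/-- `v` is the strict winner of the race with weights `W` and clocks `t`. -/
def Winner {ι : Type*} (W t : ι → ℝ) (v : ι) : Prop :=
  ∀ v', v' ≠ v → t v * W v' < t v' * W v

lemma Winner.unique {ι : Type*} {W t : ι → ℝ} {v v' : ι} (h : Winner W t v)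
    (h' : Winner W t v') : v' = v := by
  by_contra hne
  have h1 := h v' hne
  have h2 := h' v (Ne.symm hne)
  linarith

/-- The winner of the race (arbitrary if there is none). -/
def argS {ι : Type*} [Nonempty ι] (W t : ι → ℝ) : ι :=
  if h : ∃ v, Winner W t v then h.choose else Classical.arbitrary ι

lemma argS_eq {ι : Type*} [Nonempty ι] {W t : ι → ℝ} {v : ι} (h : Winner W t v) :
    argS W t = v := by
  have h' : ∃ v, Winner W t v := ⟨v, h⟩
  rw [argS, dif_pos h']
  exact h.unique h'.choose_spec

lemma winner_meas {ι : Type*} [Fintype ι] (W : ι → ℝ) (v : ι) :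
    MeasurableSet {t : ι → ℝ | Winner W t v} := by
  have : {t : ι → ℝ | Winner W t v} = ⋂ v' ∈ {v' | v' ≠ v}, {t | t v * W v' < t v' * W v} := by
    ext T; simp [Winner]
  rw [this]
  exact MeasurableSet.biInter (Set.to_countable _) fun v' _ =>
      measurableSet_lt (by fun_prop) (by fun_prop)

lemma argS_meas {ι : Type*} [Fintype ι] [Nonempty ι] (W : ι → ℝ) (v : ι) :
    MeasurableSet {t : ι → ℝ | argS W t = v} := by
  have : {t : ι → ℝ | argS W t = v} = {t | Winner W t v} ∪
      ((⋂ v', {t : ι → ℝ | Winner W t v'}ᶜ) ∩ {_t | Classical.arbitrary ι = v}) := by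
    ext t
    simp only [Set.mem_ofPred_eq, Set.mem_union, Set.mem_inter_iff, Set.mem_iInter,
      Set.mem_compl_iff]
    by_cases h : ∃ v, Winner W t v
    · obtain ⟨v', hv'⟩ := h
      rw [argS_eq hv']
      constructor
      · rintro rfl; exact Or.inl hv'
      · rintro (h | ⟨h, _⟩)
        · exact h.unique hv'
        · exact absurd hv' (h v')
    · rw [argS, dif_neg h]
      push Not at h
      constructor
      · intro e; exact Or.inr ⟨h, e⟩
      · rintro (h' | ⟨_, h'⟩)
        · exact absurd h' (h v)
        · exact h'
  rw [this]
  refine (winner_meas W v).union (MeasurableSet.inter ?_ (MeasurableSet.const _))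
  exact MeasurableSet.iInter fun v' => (winner_meas W v').compl

open MeasureTheory ProbabilityTheory in
/-- A finite form of the Poisson matching lemma. -/
lemma pml {A S U : Type*} [Fintype A] [Fintype S] [Fintype U] [Nonempty U]
    (B : ℕ) (hB : 0 < B) (w : A → U → ℝ) (w' : S → U → ℝ)
    (hw : ∀ a u, 0 ≤ w a u) (hw1 : ∀ a, ∑ u, w a u ≤ 1)
    (hw' : ∀ s u, 0 ≤ w' s u) (hw1' : ∀ s, ∑ u, w' s u ≤ 1) :
    ∃ ρ : (A → U × Fin B) × (Fin B → S → U) → ℝ, IsPMF ρ ∧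
      ∀ a s u (δ : ℝ), 0 ≤ δ → w a u ≤ δ * B * w' s u →
        w a u * (1 - δ) ≤
          ∑ f, if (f.1 a).1 = u ∧ f.2 (f.1 a).2 s = u then ρ f else 0 := by
  have : IsProbabilityMeasure (expMeasure 1) := isProbabilityMeasure_expMeasure one_pos
  have : Nonempty (Fin B) := ⟨⟨0, hB⟩⟩
  set μ := Measure.pi (fun _ : U × Fin B => expMeasure 1) with hμ
  let F : (U × Fin B → ℝ) → (A → U × Fin B) × (Fin B → S → U) := fun T =>
    (fun a => argS (fun v => w a v.1) T, fun m s => argS (w' s) (fun u => T (u, m)))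
  have hF : ∀ f, MeasurableSet {T | F T = f} := by
    intro f
    have : {T | F T = f} = (⋂ a, {T | argS (fun v : U × Fin B => w a v.1) T = f.1 a}) ∩
        ⋂ m, ⋂ s, (fun (T : U × Fin B → ℝ) u => T (u, m)) ⁻¹' {t | argS (w' s) t = f.2 m s} := by
      ext T
      simp only [Set.mem_ofPred_eq, Set.mem_inter_iff, Set.mem_iInter, Set.mem_preimage, F,
        Prod.ext_iff, funext_iff]
    rw [this]
    refine MeasurableSet.inter (MeasurableSet.iInter fun a => argS_meas _ _) ?_
    refine MeasurableSet.iInter fun m => MeasurableSet.iInter fun s => ?_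
    exact (by fun_prop : Measurable (fun (T : U × Fin B → ℝ) u => T (u, m))) (argS_meas _ _)
  have hsum : ∀ P : (A → U × Fin B) × (Fin B → S → U) → Prop, ∀ [DecidablePred P],
      (∑ f, if P f then μ.real {T | F T = f} else 0) = μ.real {T | P (F T)} := by
    intro P _
    rw [← Finset.sum_filter, ← measureReal_biUnion_finset]
    · congr 1
      ext T
      simp
    · intro f _ g _ hfg
      refine Set.disjoint_left.2 fun T h1 h2 => hfg ?_
      simp only [Set.mem_ofPred_eq] at h1 h2
      rw [← h1, h2]
    · intro f _; exact hF f
  refine ⟨fun f => μ.real {T | F T = f}, ⟨fun _ => measureReal_nonneg, ?_⟩, ?_⟩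
  · have := hsum (fun _ => True)
    simpa using this
  · intro a s u δ hδ hle
    beta_reduce
    rw [hsum fun f => (f.1 a).1 = u ∧ f.2 (f.1 a).2 s = u]
    rcases (hw a u).eq_or_lt with h0 | h0
    · rw [← h0, zero_mul]; exact measureReal_nonneg
    have hB' : (0:ℝ) < B := by exact_mod_cast hB
    have h0' : 0 < w' s u := by
      rcases (hw' s u).eq_or_lt with h | h
      · rw [← h, mul_zero] at hle; linarith
      · exact h
    let c : Fin B → U × Fin B → ℝ := fun m v =>
      max (w a v.1 / w a u) (if v.2 = m then w' s v.1 / w' s u else 0)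
    have hc : ∀ m v, 0 ≤ c m v := fun m v => le_max_of_le_left (div_nonneg (hw _ _) (hw _ _))
    let G : Fin B → Set (U × Fin B → ℝ) := fun m =>
      {T | 0 < T (u, m) ∧ ∀ v', v' ≠ (u, m) → c m v' * T (u, m) < T v'}
    have hG : ∀ m T, T ∈ G m → (F T).1 a = (u, m) ∧ (F T).2 m s = u := by
      rintro m T ⟨hT, hT'⟩
      constructor
      · apply argS_eq
        intro v' hv'
        have h1 := hT' v' hv'
        have h2 : w a v'.1 / w a u * T (u, m) < T v' :=
          lt_of_le_of_lt (mul_le_mul_of_nonneg_right (le_max_left _ _) hT.le) h1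
        have h3 := mul_lt_mul_of_pos_right h2 h0
        have h4 : w a v'.1 / w a u * T (u, m) * w a u = T (u, m) * w a v'.1 := by
          field_simp
        rw [h4] at h3
        exact h3
      · apply argS_eq
        intro u' hu'
        have h1 := hT' (u', m) (by simpa using hu')
        have h2 : w' s u' / w' s u * T (u, m) < T (u', m) := by
          refine lt_of_le_of_lt (mul_le_mul_of_nonneg_right ?_ hT.le) h1
          refine le_trans ?_ (le_max_right _ _)
          simp
        have h3 := mul_lt_mul_of_pos_right h2 h0'
        have h4 : w' s u' / w' s u * T (u, m) * w' s u = T (u, m) * w' s u' := by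
          field_simp
        rw [h4] at h3
        exact h3
    have hGp : ∀ m, w a u * (1 - δ) / B ≤ μ.real (G m) := by
      intro m
      refine le_trans ?_ (race (u, m) (c m) (hc m))
      have e1 : 1 + ∑ v' ∈ Finset.univ.erase (u, m), c m v' = ∑ v', c m v' := by
        have hcu : c m (u, m) = 1 := by simp [c, h0.ne', h0'.ne']
        rw [← hcu]
        convert Finset.add_sum_erase Finset.univ (c m) (Finset.mem_univ (u, m))
      have e2 : ∑ v', c m v' ≤ B / w a u + 1 / w' s u := by
        calc ∑ v', c m v' ≤ ∑ v' : U × Fin B, (w a v'.1 / w a u +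
              (if v'.2 = m then w' s v'.1 / w' s u else 0)) := by
              refine Finset.sum_le_sum fun v' _ => max_le_add_of_nonneg ?_ ?_
              · exact div_nonneg (hw _ _) (hw _ _)
              · split_ifs
                · exact div_nonneg (hw' _ _) (hw' _ _)
                · exact le_rfl
          _ = B * (∑ x, w a x) / w a u + (∑ x, w' s x) / w' s u := by
              rw [Finset.sum_add_distrib]
              congr 1
              · rw [Fintype.sum_prod_type]
                simp [Finset.mul_sum, Finset.sum_div, mul_div_assoc]
              · rw [Fintype.sum_prod_type]
                simp [Finset.sum_div]
          _ ≤ B / w a u + 1 / w' s u := by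
              refine add_le_add ?_ ?_
              · apply div_le_div_of_nonneg_right _ h0.le
                calc B * (∑ x, w a x) ≤ B * 1 := mul_le_mul_of_nonneg_left (hw1 a) hB'.le
                  _ = B := mul_one _
              · exact div_le_div_of_nonneg_right (hw1' s) h0'.le
      have e3 : 0 < 1 + ∑ v' ∈ Finset.univ.erase (u, m), c m v' :=
        add_pos_of_pos_of_nonneg one_pos (Finset.sum_nonneg fun _ _ => hc _ _)
      rw [e1] at e3 ⊢
      refine le_trans ?_ (one_div_le_one_div_of_le e3 e2)
      have e4 : B / w a u + 1 / w' s u = (B * w' s u + w a u) / (w a u * w' s u) := by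
        field_simp
      rw [e4, one_div_div, div_le_div_iff₀ hB' (by positivity)]
      have e5 : (1 - δ) * (B * w' s u + w a u) ≤ B * w' s u := by
        nlinarith [mul_nonneg hδ h0.le]
      nlinarith [mul_le_mul_of_nonneg_left e5 h0.le]
    calc w a u * (1 - δ) = ∑ m : Fin B, w a u * (1 - δ) / B := by
          simp; field_simp
      _ ≤ ∑ m, μ.real (G m) := Finset.sum_le_sum fun m _ => hGp m
      _ ≤ ∑ m, μ.real {T | (F T).1 a = (u, m) ∧ (F T).2 m s = u} :=
          Finset.sum_le_sum fun m _ => measureReal_mono (fun T hT => hG m T hT)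
      _ = ∑ m, ∑ f : (A → U × Fin B) × (Fin B → S → U), if f.1 a = (u, m) ∧ f.2 m s = u
            then μ.real {T | F T = f} else 0 :=
          Finset.sum_congr rfl fun m _ => (hsum fun f => f.1 a = (u, m) ∧ f.2 m s = u).symm
      _ = ∑ f : (A → U × Fin B) × (Fin B → S → U),
            if (f.1 a).1 = u ∧ f.2 (f.1 a).2 s = u then μ.real {T | F T = f} else 0 := by
          rw [Finset.sum_comm]
          refine Finset.sum_congr rfl fun f _ => ?_
          rw [Finset.sum_eq_single (f.1 a).2]
          · congr 1
            simp only [Prod.ext_iff, and_true]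
          · intro m _ hm
            rw [if_neg]
            rintro ⟨h, _⟩
            rw [h] at hm; exact hm rfl
          · simp
      _ = _ := hsum fun f => (f.1 a).1 = u ∧ f.2 (f.1 a).2 s = u


/-- A family of sub-probability mass functions. -/
def IsSub {A U : Type*} [Fintype U] (w : A → U → ℝ) : Prop :=
  (∀ a u, 0 ≤ w a u) ∧ ∀ a, ∑ u, w a u ≤ 1

lemma exists_avg {F J : Type*} [Fintype F] [Fintype J] (ρ : F → ℝ) (hρ : IsPMF ρ)
    (a b : J → ℝ) (ha : ∀ j, 0 ≤ a j) (I : F → J → Prop) [∀ f j, Decidable (I f j)]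
    (h : ∀ j, a j ≠ 0 → b j ≤ ∑ f, if I f j then ρ f else 0) :
    ∃ f, ∑ j, a j * b j ≤ ∑ j, if I f j then a j else 0 := by
  by_contra hcon
  push Not at hcon
  have h1 : ∑ j, a j * b j ≤ ∑ f, ρ f * ∑ j, (if I f j then a j else 0) := by
    calc ∑ j, a j * b j ≤ ∑ j, a j * ∑ f, (if I f j then ρ f else 0) := by
          refine Finset.sum_le_sum fun j _ => ?_
          by_cases hj : a j = 0
          · simp [hj]
          · exact mul_le_mul_of_nonneg_left (h j hj) (ha j)
      _ = _ := by
          simp only [Finset.mul_sum]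
          rw [Finset.sum_comm]
          refine Finset.sum_congr rfl fun f _ => Finset.sum_congr rfl fun j _ => ?_
          split_ifs
          · ring
          · simp
  have h2 : ∑ f, ρ f * ∑ j, (if I f j then a j else 0) < ∑ f, ρ f * ∑ j, a j * b j := by
    apply Finset.sum_lt_sum
    · intro f _
      exact mul_le_mul_of_nonneg_left (hcon f).le (hρ.1 f)
    · by_contra hz
      push Not at hz
      have : ∀ f, ρ f = 0 := by
        intro f
        have h3 := hz f (Finset.mem_univ f)
        rcases (hρ.1 f).eq_or_lt with h4 | h4
        · exact h4.symm
        · have := mul_lt_mul_of_pos_left (hcon f) h4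
          linarith
      have h5 := hρ.2
      simp [this] at h5
  rw [← Finset.sum_mul, hρ.2, one_mul] at h2
  linarith

/-- The matching lemma combined with averaging. -/
lemma pml_avg {A S U J : Type*} [Fintype A] [Fintype S] [Fintype U] [Nonempty U] [Fintype J]
    (B : ℕ) (hB : 0 < B) (w : A → U → ℝ) (w' : S → U → ℝ) (hw : IsSub w) (hw' : IsSub w')
    (δ : ℝ) (hδ : 0 ≤ δ) (jA : J → A) (jS : J → S) (jU : J → U) (a : J → ℝ) (ha : ∀ j, 0 ≤ a j)
    (h : ∀ j, a j ≠ 0 → w (jA j) (jU j) ≤ δ * B * w' (jS j) (jU j)) :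
    ∃ f : (A → U × Fin B) × (Fin B → S → U),
      ∑ j, a j * (w (jA j) (jU j) * (1 - δ)) ≤
        ∑ j, if (f.1 (jA j)).1 = jU j ∧ f.2 (f.1 (jA j)).2 (jS j) = jU j then a j else 0 := by
  obtain ⟨ρ, hρ, h1⟩ := pml B hB w w' hw.1 hw.2 hw'.1 hw'.2
  exact exists_avg ρ hρ a (fun j => w (jA j) (jU j) * (1 - δ)) ha
    (fun f j => (f.1 (jA j)).1 = jU j ∧ f.2 (f.1 (jA j)).2 (jS j) = jU j)
    (fun j hj => h1 _ _ _ δ hδ (h j hj))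

/-- One-shot Slepian–Wolf. -/
lemma sw_oneshot {Ω V S : Type*} [Fintype Ω] [Fintype V] [Fintype S] [Nonempty V]
    (p : Ω → ℝ) (hp : ∀ ω, 0 ≤ p ω) (fV : Ω → V) (fS : Ω → S) (w' : S → V → ℝ) (hw' : IsSub w')
    (K : ℕ) (hK : 0 < K) (δ : ℝ) (hδ : 0 ≤ δ) (T : Ω → Prop)
    (hT : ∀ ω, T ω → 1 ≤ δ * K * w' (fS ω) (fV ω)) :
    ∃ (enc : V → Fin K) (dec : Fin K → S → V),
      ∑ ω, (if T ω then p ω else 0) * (1 - δ) ≤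
        ∑ ω, if dec (enc (fV ω)) (fS ω) = fV ω then p ω else 0 := by
  obtain ⟨f, hf⟩ := pml_avg K hK (fun a u : V => if a = u then (1 : ℝ) else 0) w'
    ⟨fun a u => by beta_reduce; split_ifs <;> norm_num, fun a => by simp⟩ hw' δ hδ fV fS fV
    (fun ω => if T ω then p ω else 0) (fun ω => by beta_reduce; split_ifs; exacts [hp ω, le_rfl])
    (by
      intro ω hω
      have hTω : T ω := by
        by_contra hc
        simp [hc] at hω
      simpa using hT ω hTω)
  simp only [if_true, one_mul] at hf
  refine ⟨fun a => (f.1 a).2, f.2, hf.trans (Finset.sum_le_sum fun ω _ => ?_)⟩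
  by_cases h1 : f.2 (f.1 (fV ω)).2 (fS ω) = fV ω
  · rw [if_pos h1]
    split_ifs
    exacts [le_rfl, hp ω, hp ω]
  · rw [if_neg h1, if_neg]
    exact fun h2 => h1 h2.2

/-- One-shot pair of nested Wyner–Ziv codes. -/
lemma wz_oneshot {Ω 𝒳 𝒴 𝒵 U1 U2 : Type*} [Fintype Ω] [Fintype 𝒳] [Fintype 𝒴] [Fintype 𝒵]
    [Fintype U1] [Fintype U2] [Nonempty U1] [Nonempty U2]
    (p : Ω → ℝ) (hp : ∀ ω, 0 ≤ p ω) (fX : Ω → 𝒳) (fY : Ω → 𝒴) (fZ : Ω → 𝒵)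
    (Q1 : 𝒳 → U1 → ℝ) (hQ1 : IsSub Q1) (Q2 : 𝒴 × 𝒵 × U1 → U2 → ℝ) (hQ2 : IsSub Q2)
    (P1 : 𝒴 × 𝒵 → U1 → ℝ) (hP1 : IsSub P1) (P2 : 𝒳 × 𝒵 × U1 → U2 → ℝ) (hP2 : IsSub P2)
    (B1 B2 : ℕ) (hB1 : 0 < B1) (hB2 : 0 < B2) (δ : ℝ) (hδ : 0 ≤ δ) (hδ1 : δ ≤ 1)
    (G : Ω → U1 → U2 → Prop)
    (hG1 : ∀ ω u1 u2, G ω u1 u2 → Q1 (fX ω) u1 ≤ δ * B1 * P1 (fY ω, fZ ω) u1)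
    (hG2 : ∀ ω u1 u2, G ω u1 u2 →
      Q2 (fY ω, fZ ω, u1) u2 ≤ δ * B2 * P2 (fX ω, fZ ω, u1) u2) :
    ∃ (f1 : (𝒳 → U1 × Fin B1) × (Fin B1 → 𝒴 × 𝒵 → U1))
      (f2 : (𝒴 × 𝒵 × U1 → U2 × Fin B2) × (Fin B2 → 𝒳 × 𝒵 × U1 → U2)),
      (∑ ω, ∑ u1, ∑ u2, if G ω u1 u2 then
        p ω * Q1 (fX ω) u1 * Q2 (fY ω, fZ ω, u1) u2 * (1 - δ) ^ 2 else 0) ≤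
      ∑ ω, if (∃ u1 u2, G ω u1 u2 ∧ (f1.1 (fX ω)).1 = u1 ∧
          f1.2 (f1.1 (fX ω)).2 (fY ω, fZ ω) = u1 ∧ (f2.1 (fY ω, fZ ω, u1)).1 = u2 ∧
          f2.2 (f2.1 (fY ω, fZ ω, u1)).2 (fX ω, fZ ω, u1) = u2) then p ω else 0 := by
  have hδ' : 0 ≤ 1 - δ := by linarith
  obtain ⟨f1, hf1⟩ := pml_avg B1 hB1 Q1 P1 hQ1 hP1 δ hδ (fun j : Ω × U1 × U2 => fX j.1)
    (fun j => (fY j.1, fZ j.1)) (fun j => j.2.1)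
    (fun j : Ω × U1 × U2 => if G j.1 j.2.1 j.2.2 then
      p j.1 * Q2 (fY j.1, fZ j.1, j.2.1) j.2.2 * (1 - δ) else 0)
    (fun j => by
      beta_reduce
      split_ifs
      · exact mul_nonneg (mul_nonneg (hp _) (hQ2.1 _ _)) hδ'
      · exact le_rfl)
    (by
      intro j hj
      have hGj : G j.1 j.2.1 j.2.2 := by
        by_contra hc
        simp [hc] at hj
      exact hG1 _ _ _ hGj)
  let I1 : Ω × U1 × U2 → Prop := fun j =>
    (f1.1 (fX j.1)).1 = j.2.1 ∧ f1.2 (f1.1 (fX j.1)).2 (fY j.1, fZ j.1) = j.2.1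
  obtain ⟨f2, hf2⟩ := pml_avg B2 hB2 Q2 P2 hQ2 hP2 δ hδ
    (fun j : Ω × U1 × U2 => (fY j.1, fZ j.1, j.2.1))
    (fun j => (fX j.1, fZ j.1, j.2.1)) (fun j => j.2.2)
    (fun j : Ω × U1 × U2 => if G j.1 j.2.1 j.2.2 ∧ I1 j then p j.1 else 0)
    (fun j => by
      beta_reduce
      split_ifs
      · exact hp _
      · exact le_rfl)
    (by
      intro j hj
      have hGj : G j.1 j.2.1 j.2.2 := by
        by_contra hc
        simp [hc] at hj
      exact hG2 _ _ _ hGj)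
  refine ⟨f1, f2, ?_⟩
  calc _ = ∑ j : Ω × U1 × U2, (if G j.1 j.2.1 j.2.2 then
      p j.1 * Q2 (fY j.1, fZ j.1, j.2.1) j.2.2 * (1 - δ) else 0) *
        (Q1 (fX j.1) j.2.1 * (1 - δ)) := by
        rw [Fintype.sum_prod_type]
        refine Finset.sum_congr rfl fun ω _ => ?_
        rw [Fintype.sum_prod_type]
        refine Finset.sum_congr rfl fun u1 _ => Finset.sum_congr rfl fun u2 _ => ?_
        split_ifs
        · ring
        · simp
    _ ≤ _ := hf1
    _ = ∑ j : Ω × U1 × U2, (if G j.1 j.2.1 j.2.2 ∧ I1 j then p j.1 else 0) *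
          (Q2 (fY j.1, fZ j.1, j.2.1) j.2.2 * (1 - δ)) := by
        refine Finset.sum_congr rfl fun j _ => ?_
        by_cases hg : G j.1 j.2.1 j.2.2 <;> by_cases hi : I1 j
        · have hi' := hi
          simp only [I1] at hi'
          simp only [hg, hi, hi', and_self, if_true]
          ring
        · have hi' := hi
          simp only [I1] at hi'
          rw [if_neg hi', if_neg (fun h => hi h.2), zero_mul]
        · simp [hg]
        · simp [hg]
    _ ≤ _ := hf2
    _ ≤ _ := by
        rw [Fintype.sum_prod_type]
        refine Finset.sum_le_sum fun ω _ => ?_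
        rw [Fintype.sum_prod_type]
        rw [Finset.sum_eq_single (f1.1 (fX ω)).1, Finset.sum_eq_single
          (f2.1 (fY ω, fZ ω, (f1.1 (fX ω)).1)).1]
        · by_cases hE : (∃ u1 u2, G ω u1 u2 ∧ (f1.1 (fX ω)).1 = u1 ∧
            f1.2 (f1.1 (fX ω)).2 (fY ω, fZ ω) = u1 ∧ (f2.1 (fY ω, fZ ω, u1)).1 = u2 ∧
            f2.2 (f2.1 (fY ω, fZ ω, u1)).2 (fX ω, fZ ω, u1) = u2)
          · rw [if_pos hE]
            split_ifs
            exacts [le_rfl, hp ω, hp ω]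
          · rw [if_neg hE]
            split_ifs with ha hb
            · exact absurd ⟨_, _, hb.1, rfl, hb.2.2, rfl, ha.2⟩ hE
            · exact le_rfl
            · exact le_rfl
        · intro u2 _ hu2
          rw [if_neg]
          rintro ⟨h, _⟩
          exact hu2 h.symm
        · simp
        · intro u1 _ hu1
          refine Finset.sum_eq_zero fun u2 _ => ?_
          have : ¬ (G ω u1 u2 ∧ I1 (ω, u1, u2)) := by
            rintro ⟨_, h, _⟩
            exact hu1 h.symm
          simp [this]
        · simp

lemma oneshot {Ω 𝒳 𝒴 𝒵 U1 U2 : Type*} [Fintype Ω] [Fintype 𝒳] [Fintype 𝒴] [Fintype 𝒵]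
    [Fintype U1] [Fintype U2] [Nonempty U1] [Nonempty U2] [Nonempty 𝒵]
    (p : Ω → ℝ) (hp : IsPMF p) (fX : Ω → 𝒳) (fY : Ω → 𝒴) (fZ : Ω → 𝒵)
    (Q1 : 𝒳 → U1 → ℝ) (hQ1 : IsSub Q1) (Q2 : 𝒴 × 𝒵 × U1 → U2 → ℝ) (hQ2 : IsSub Q2)
    (P1 : 𝒴 × 𝒵 → U1 → ℝ) (hP1 : IsSub P1) (P2 : 𝒳 × 𝒵 × U1 → U2 → ℝ) (hP2 : IsSub P2)
    (R1 : 𝒴 → 𝒳 × 𝒵 → ℝ) (hR1 : IsSub R1) (R2 : 𝒳 → 𝒴 × 𝒵 → ℝ) (hR2 : IsSub R2)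
    (B1 B2 K1 K2 : ℕ) (hB1 : 0 < B1) (hB2 : 0 < B2) (hK1 : 0 < K1) (hK2 : 0 < K2)
    (δ : ℝ) (hδ : 0 ≤ δ) (hδ1 : δ ≤ 1)
    (G : Ω → U1 → U2 → Prop)
    (hG1 : ∀ ω u1 u2, G ω u1 u2 → Q1 (fX ω) u1 ≤ δ * B1 * P1 (fY ω, fZ ω) u1)
    (hG2 : ∀ ω u1 u2, G ω u1 u2 →
      Q2 (fY ω, fZ ω, u1) u2 ≤ δ * B2 * P2 (fX ω, fZ ω, u1) u2)
    (T1 T2 : Ω → Prop)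
    (hT1 : ∀ ω, T1 ω → 1 ≤ δ * K1 * R1 (fY ω) (fX ω, fZ ω))
    (hT2 : ∀ ω, T2 ω → 1 ≤ δ * K2 * R2 (fX ω) (fY ω, fZ ω))
    (η : ℝ)
    (h1 : 1 - η ≤ ∑ ω, ∑ u1, ∑ u2, if G ω u1 u2 then
        p ω * Q1 (fX ω) u1 * Q2 (fY ω, fZ ω, u1) u2 * (1 - δ) ^ 2 else 0)
    (h2 : 1 - η ≤ ∑ ω, (if T1 ω then p ω else 0) * (1 - δ))
    (h3 : 1 - η ≤ ∑ ω, (if T2 ω then p ω else 0) * (1 - δ)) :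
    ∃ (φAR : 𝒳 → Fin B1) (φRB : 𝒵 → Fin B1 → Fin K1) (φBR : 𝒴 → Fin K1 → Fin B2)
      (φRA : 𝒵 → Fin B1 → Fin B2 → Fin K2) (dB : 𝒴 → Fin K1 → 𝒵 × U1)
      (dA : 𝒳 → Fin K2 → 𝒵 × U1 × U2),
      1 - 3 * η ≤ ∑ ω, if (∃ u1 u2, G ω u1 u2 ∧
        dB (fY ω) (φRB (fZ ω) (φAR (fX ω))) = (fZ ω, u1) ∧
        dA (fX ω) (φRA (fZ ω) (φAR (fX ω))
          (φBR (fY ω) (φRB (fZ ω) (φAR (fX ω))))) = (fZ ω, u1, u2)) then p ω else 0 := by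
  have : Nonempty (Fin B1) := ⟨⟨0, hB1⟩⟩
  have : Nonempty (Fin B2) := ⟨⟨0, hB2⟩⟩
  obtain ⟨f1, f2, hf⟩ := wz_oneshot p hp.1 fX fY fZ Q1 hQ1 Q2 hQ2 P1 hP1 P2 hP2 B1 B2 hB1 hB2
    δ hδ hδ1 G hG1 hG2
  let w1 : 𝒴 → 𝒵 × Fin B1 → ℝ := fun y v => ∑ x, if (f1.1 x).2 = v.2 then R1 y (x, v.1) else 0
  have hw1 : IsSub w1 := by
    refine ⟨fun y v => Finset.sum_nonneg fun x _ => ?_, fun y => ?_⟩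
    · split_ifs
      exacts [hR1.1 _ _, le_rfl]
    · refine le_trans (le_of_eq ?_) (hR1.2 y)
      simp only [w1]
      rw [Finset.sum_comm, Fintype.sum_prod_type]
      refine Finset.sum_congr rfl fun x _ => ?_
      rw [Fintype.sum_prod_type]
      refine Finset.sum_congr rfl fun z _ => ?_
      simp
  let m2 : 𝒳 → 𝒴 → 𝒵 → Fin B2 := fun x y z => (f2.1 (y, z, (f1.1 x).1)).2
  let w2 : 𝒳 → 𝒵 × Fin B2 → ℝ := fun x v => ∑ y, if m2 x y v.1 = v.2 then R2 x (y, v.1) else 0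
  have hw2 : IsSub w2 := by
    refine ⟨fun y v => Finset.sum_nonneg fun x _ => ?_, fun y => ?_⟩
    · split_ifs
      exacts [hR2.1 _ _, le_rfl]
    · refine le_trans (le_of_eq ?_) (hR2.2 y)
      simp only [w2]
      rw [Finset.sum_comm, Fintype.sum_prod_type]
      refine Finset.sum_congr rfl fun x _ => ?_
      rw [Fintype.sum_prod_type]
      refine Finset.sum_congr rfl fun z _ => ?_
      simp
  have hle1 : ∀ x y z, R1 y (x, z) ≤ w1 y (z, (f1.1 x).2) := by
    intro x y z
    have h := Finset.single_le_sum (f := fun x' => if (f1.1 x').2 = (f1.1 x).2 then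
        R1 y (x', z) else 0) (fun x' _ => by
          beta_reduce; split_ifs; exacts [hR1.1 _ _, le_rfl]) (Finset.mem_univ x)
    beta_reduce at h
    rw [if_pos rfl] at h
    exact h
  have hle2 : ∀ x y z, R2 x (y, z) ≤ w2 x (z, m2 x y z) := by
    intro x y z
    have h := Finset.single_le_sum (f := fun y' => if m2 x y' z = m2 x y z then
        R2 x (y', z) else 0) (fun y' _ => by
          beta_reduce; split_ifs; exacts [hR2.1 _ _, le_rfl]) (Finset.mem_univ y)
    beta_reduce at h
    rw [if_pos rfl] at h
    exact h
  obtain ⟨e3, d3, hsw1⟩ := sw_oneshot p hp.1 (fun ω => (fZ ω, (f1.1 (fX ω)).2)) fY w1 hw1 K1 hK1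
    δ hδ T1 (fun ω hω => (hT1 ω hω).trans (mul_le_mul_of_nonneg_left (hle1 _ _ _)
      (by positivity)))
  obtain ⟨e4, d4, hsw2⟩ := sw_oneshot p hp.1 (fun ω => (fZ ω, m2 (fX ω) (fY ω) (fZ ω))) fX w2 hw2
    K2 hK2 δ hδ T2 (fun ω hω => (hT2 ω hω).trans (mul_le_mul_of_nonneg_left (hle2 _ _ _)
      (by positivity)))
  refine ⟨fun x => (f1.1 x).2, fun z m => e3 (z, m),
    fun y k => (f2.1 (y, (d3 k y).1, f1.2 (d3 k y).2 (y, (d3 k y).1))).2,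
    fun z _ m => e4 (z, m), fun y k => ((d3 k y).1, f1.2 (d3 k y).2 (y, (d3 k y).1)),
    fun x k => ((d4 k x).1, (f1.1 x).1, f2.2 (d4 k x).2 (x, (d4 k x).1, (f1.1 x).1)), ?_⟩
  have hu : ∀ (A B C D : Ω → Prop) {_ : DecidablePred A} {_ : DecidablePred B}
      {_ : DecidablePred C} {_ : DecidablePred D}, (∀ ω, A ω → B ω → C ω → D ω) →
      (∑ ω, if A ω then p ω else 0) + (∑ ω, if B ω then p ω else 0) +
        (∑ ω, if C ω then p ω else 0) - 2 ≤ ∑ ω, if D ω then p ω else 0 := by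
    intro A B C D _ _ _ _ hABC
    have e : (2:ℝ) = ∑ ω, 2 * p ω := by rw [← Finset.mul_sum, hp.2]; norm_num
    rw [e, ← Finset.sum_add_distrib, ← Finset.sum_add_distrib, ← Finset.sum_sub_distrib]
    refine Finset.sum_le_sum fun ω _ => ?_
    have := hp.1 ω
    have h := hABC ω
    by_cases hA : A ω <;> by_cases hB : B ω <;> by_cases hC : C ω <;> by_cases hD : D ω <;>
      simp only [hA, hB, hC, hD, if_true, if_false] <;> first | linarith | (exfalso; tauto)
  have htot := add_le_add (add_le_add (h1.trans hf) (h2.trans hsw1)) (h3.trans hsw2)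
  have htot2 := sub_le_sub_right htot 2
  have he : 1 - 3 * η = (1 - η + (1 - η) + (1 - η)) - 2 := by ring
  rw [he]
  refine htot2.trans ?_
  refine hu (fun ω => ∃ u1 u2, G ω u1 u2 ∧ (f1.1 (fX ω)).1 = u1 ∧
          f1.2 (f1.1 (fX ω)).2 (fY ω, fZ ω) = u1 ∧ (f2.1 (fY ω, fZ ω, u1)).1 = u2 ∧
          f2.2 (f2.1 (fY ω, fZ ω, u1)).2 (fX ω, fZ ω, u1) = u2)
    (fun ω => d3 (e3 (fZ ω, (f1.1 (fX ω)).2)) (fY ω) = (fZ ω, (f1.1 (fX ω)).2))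
    (fun ω => d4 (e4 (fZ ω, m2 (fX ω) (fY ω) (fZ ω))) (fX ω) = (fZ ω, m2 (fX ω) (fY ω) (fZ ω)))
    _ ?_
  · rintro ω ⟨u1, u2, hg, a1, a2, a3, a4⟩ b c
    refine ⟨u1, u2, hg, ?_, ?_⟩
    · simp only [b, a2]
    · subst a1
      simp only [b, a2]
      have c' : d4 (e4 (fZ ω, (f2.1 (fY ω, fZ ω, (f1.1 (fX ω)).1)).2)) (fX ω) =
        (fZ ω, (f2.1 (fY ω, fZ ω, (f1.1 (fX ω)).1)).2) := c
      simp only [c', a4]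

lemma oneshot' {Ω 𝒳 𝒴 𝒵 U1 U2 : Type*} [Fintype Ω] [Fintype 𝒳] [Fintype 𝒴] [Fintype 𝒵]
    [Fintype U1] [Fintype U2] [Nonempty U1] [Nonempty U2] [Nonempty 𝒵]
    (p : Ω → ℝ) (hp : IsPMF p) (fX : Ω → 𝒳) (fY : Ω → 𝒴) (fZ : Ω → 𝒵)
    (Q1 : 𝒳 → U1 → ℝ) (hQ1 : IsSub Q1) (Q2 : 𝒴 × 𝒵 × U1 → U2 → ℝ) (hQ2 : IsSub Q2)
    (P1 : 𝒴 × 𝒵 → U1 → ℝ) (hP1 : IsSub P1) (P2 : 𝒳 × 𝒵 × U1 → U2 → ℝ) (hP2 : IsSub P2)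
    (R1 : 𝒴 → 𝒳 × 𝒵 → ℝ) (hR1 : IsSub R1) (R2 : 𝒳 → 𝒴 × 𝒵 → ℝ) (hR2 : IsSub R2)
    (B1 B2 K1 K2 : ℕ) (hB1 : 0 < B1) (hB2 : 0 < B2) (hK1 : 0 < K1) (hK2 : 0 < K2)
    (δ : ℝ) (hδ : 0 ≤ δ) (hδ1 : δ ≤ 1)
    (G : Ω → U1 → U2 → Prop)
    (hG1 : ∀ ω u1 u2, G ω u1 u2 → Q1 (fX ω) u1 ≤ δ * B1 * P1 (fY ω, fZ ω) u1)
    (hG2 : ∀ ω u1 u2, G ω u1 u2 →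
      Q2 (fY ω, fZ ω, u1) u2 ≤ δ * B2 * P2 (fX ω, fZ ω, u1) u2)
    (T1 T2 : Ω → Prop)
    (hT1 : ∀ ω, T1 ω → 1 ≤ δ * K1 * R1 (fY ω) (fX ω, fZ ω))
    (hT2 : ∀ ω, T2 ω → 1 ≤ δ * K2 * R2 (fX ω) (fY ω, fZ ω))
    (η : ℝ)
    (h1 : 1 - η ≤ ∑ ω, ∑ u1, ∑ u2, if G ω u1 u2 then
        p ω * Q1 (fX ω) u1 * Q2 (fY ω, fZ ω, u1) u2 * (1 - δ) ^ 2 else 0)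
    (h2 : 1 - η ≤ ∑ ω, (if T1 ω then p ω else 0) * (1 - δ))
    (h3 : 1 - η ≤ ∑ ω, (if T2 ω then p ω else 0) * (1 - δ)) :
    ∃ (φAR : 𝒳 → Fin B1) (φRB : 𝒵 → Fin B1 → Fin K1) (φBR : 𝒴 → Fin K1 → Fin B2)
      (φRA : 𝒵 → Fin B1 → Fin B2 → Fin K2) (dB : 𝒴 → Fin K1 → 𝒵 × U1)
      (dA : 𝒳 → Fin K2 → 𝒵 × U1 × U2),
      ∃ S : Ω → Prop, (∀ ω, S ω → ∃ u1 u2, G ω u1 u2 ∧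
        dB (fY ω) (φRB (fZ ω) (φAR (fX ω))) = (fZ ω, u1) ∧
        dA (fX ω) (φRA (fZ ω) (φAR (fX ω))
          (φBR (fY ω) (φRB (fZ ω) (φAR (fX ω))))) = (fZ ω, u1, u2)) ∧
      1 - 3 * η ≤ ∑ ω, if S ω then p ω else 0 := by
  obtain ⟨φAR, φRB, φBR, φRA, decB, decA, hmain⟩ := oneshot p hp fX fY fZ Q1 hQ1 Q2 hQ2 P1 hP1 P2
    hP2 R1 hR1 R2 hR2 B1 B2 K1 K2 hB1 hB2 hK1 hK2 δ hδ hδ1 G hG1 hG2 T1 T2 hT1 hT2 η h1 h2 h3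
  refine ⟨φAR, φRB, φBR, φRA, decB, decA, _, fun ω h => h, hmain.trans (le_of_eq ?_)⟩
  refine Finset.sum_congr rfl fun ω _ => ?_
  congr 1

lemma sum_prod_pow {W : Type*} [Fintype W] (f : W → ℝ) (n : ℕ) :
    ∑ w : Fin n → W, ∏ i, f (w i) = (∑ a, f a) ^ n := by
  have h := Fintype.prod_sum (fun (_ : Fin n) (a : W) => f a)
  rw [Finset.prod_const, Finset.card_univ, Fintype.card_fin] at h
  rw [h]

lemma iid_isPMF {W : Type*} [Fintype W] (q : W → ℝ) (hq : IsPMF q) (n : ℕ) :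
    IsPMF (iid q n) := by
  refine ⟨fun w => Finset.prod_nonneg fun i _ => hq.1 _, ?_⟩
  have := sum_prod_pow q n
  rw [hq.2, one_pow] at this
  exact this

lemma lln {W : Type*} [Fintype W] (q : W → ℝ) (hq : IsPMF q) (g : W → ℝ) (m : ℝ)
    (hm : expect q g ≤ m) (δ : ℝ) (hδ : 0 < δ) (η : ℝ) (hη : 0 < η) :
    ∃ N : ℕ, ∀ n ≥ N, ∑ w : Fin n → W,
      (if (n : ℝ) * (m + δ) < ∑ i, g (w i) then iid q n w else 0) ≤ η := by
  let h : W → ℝ := fun a => g a - m - δ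
  let M : ℝ := 1 + ∑ a, |h a|
  have hM1 : 1 ≤ M := by
    have : 0 ≤ ∑ a, |h a| := Finset.sum_nonneg fun _ _ => abs_nonneg _
    simp only [M]; linarith
  have hM : ∀ a, |h a| ≤ M := by
    intro a
    have := Finset.single_le_sum (f := fun a => |h a|) (fun a _ => abs_nonneg _)
      (Finset.mem_univ a)
    simp only [M]; linarith
  have hM0 : 0 < M := by linarith
  let s : ℝ := min (1 / M) (δ / (2 * M ^ 2))
  have hs : 0 < s := lt_min (by positivity) (by positivity)
  have hs1 : s * M ≤ 1 := by
    have := min_le_left (1 / M) (δ / (2 * M ^ 2))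
    calc s * M ≤ 1 / M * M := by gcongr
      _ = 1 := by field_simp
  have hs2 : s * M ^ 2 ≤ δ / 2 := by
    have := min_le_right (1 / M) (δ / (2 * M ^ 2))
    calc s * M ^ 2 ≤ δ / (2 * M ^ 2) * M ^ 2 := by gcongr
      _ = δ / 2 := by field_simp
  have hexp : ∀ a, Real.exp (s * h a) ≤ 1 + s * h a + s * (δ / 2) := by
    intro a
    have h1 : |s * h a| ≤ 1 := by
      rw [abs_mul, abs_of_pos hs]
      exact (mul_le_mul_of_nonneg_left (hM a) hs.le).trans hs1
    have h2 := (abs_le.1 (Real.abs_exp_sub_one_sub_id_le h1)).2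
    have h3 : (s * h a) ^ 2 ≤ s * (δ / 2) := by
      have : (h a) ^ 2 ≤ M ^ 2 := by
        rw [← sq_abs]; gcongr; exact hM a
      calc (s * h a) ^ 2 = s * (s * (h a) ^ 2) := by ring
        _ ≤ s * (s * M ^ 2) := by gcongr
        _ ≤ s * (δ / 2) := by gcongr
    linarith
  let r : ℝ := ∑ a, q a * Real.exp (s * h a)
  have hr0 : 0 ≤ r := Finset.sum_nonneg fun a _ => mul_nonneg (hq.1 a) (Real.exp_pos _).le
  have hr1 : r < 1 := by
    have h1 : r ≤ ∑ a, (q a * (1 + s * (δ / 2) - s * m - s * δ) + s * (q a * g a)) := by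
      refine Finset.sum_le_sum fun a _ => ?_
      have := mul_le_mul_of_nonneg_left (hexp a) (hq.1 a)
      refine this.trans (le_of_eq ?_)
      simp only [h]; ring
    rw [Finset.sum_add_distrib, ← Finset.sum_mul, ← Finset.mul_sum, hq.2] at h1
    have h2 : s * ∑ a, q a * g a ≤ s * m := mul_le_mul_of_nonneg_left hm hs.le
    have h3 : 0 < s * δ := by positivity
    linarith
  obtain ⟨N, hN⟩ := ((tendsto_pow_atTop_nhds_zero_of_lt_one hr0 hr1).eventually
    (gt_mem_nhds hη)).exists_forall_of_atTop
  refine ⟨N, fun n hn => le_trans ?_ (hN n hn).le⟩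
  have := sum_prod_pow (fun a => q a * Real.exp (s * h a)) n
  simp only [r]
  rw [← this]
  refine Finset.sum_le_sum fun w _ => ?_
  have hnn : 0 ≤ iid q n w := (iid_isPMF q hq n).1 w
  rw [Finset.prod_mul_distrib, ← Real.exp_sum, ← Finset.mul_sum]
  change _ ≤ iid q n w * _
  split_ifs with hc
  · refine le_mul_of_one_le_right hnn ?_
    rw [Real.one_le_exp_iff]
    refine mul_nonneg hs.le ?_
    simp only [h, Finset.sum_sub_distrib, Finset.sum_const, Finset.card_univ, Fintype.card_fin,
      nsmul_eq_mul]
    linarith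
  · positivity

lemma isSub_pow {A V : Type*} [Fintype V] (K : A → V → ℝ) (hK : IsSub K) (n : ℕ) :
    IsSub (fun (a : Fin n → A) (v : Fin n → V) => ∏ i, K (a i) (v i)) := by
  refine ⟨fun a v => Finset.prod_nonneg fun i _ => hK.1 _ _, fun a => ?_⟩
  have h := Fintype.prod_sum (fun (i : Fin n) (v : V) => K (a i) v)
  have h2 : ∏ i, ∑ v, K (a i) v ≤ 1 :=
    Finset.prod_le_one (fun i _ => Finset.sum_nonneg fun v _ => hK.1 _ _) fun i _ => hK.2 _
  rw [h] at h2
  refine le_trans (le_of_eq ?_) h2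
  refine Finset.sum_congr ?_ fun _ _ => rfl
  ext; simp

lemma isSub_comp {A A' V : Type*} [Fintype V] (K : A → V → ℝ) (hK : IsSub K) (f : A' → A) :
    IsSub (fun a => K (f a)) := ⟨fun a => hK.1 _, fun a => hK.2 _⟩

lemma sum_arrow_prod {A B : Type*} [Fintype A] [Fintype B] (n : ℕ)
    (F : (Fin n → A) → (Fin n → B) → ℝ) :
    ∑ v : Fin n → A × B, F (fun i => (v i).1) (fun i => (v i).2) = ∑ a, ∑ b, F a b := by
  rw [← Fintype.sum_prod_type']
  exact Fintype.sum_equiv (Equiv.arrowProdEquivProdArrow (Fin n) (fun _ => A) (fun _ => B)) _ _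
    (fun v => rfl)

lemma isSub_pow_prod {A V V' : Type*} [Fintype V] [Fintype V'] (K : A → V × V' → ℝ)
    (hK : IsSub K) (n : ℕ) :
    IsSub (fun (a : Fin n → A) (v : (Fin n → V) × (Fin n → V')) =>
      ∏ i, K (a i) (v.1 i, v.2 i)) := by
  refine ⟨fun a v => Finset.prod_nonneg fun i _ => hK.1 _ _, fun a => ?_⟩
  rw [Fintype.sum_prod_type]
  beta_reduce
  rw [← sum_arrow_prod n (fun x y => ∏ i, K (a i) (x i, y i))]
  exact (isSub_pow K hK n).2 a

lemma prod_le_of_log {n : ℕ} (a b : Fin n → ℝ) (ha : ∀ i, 0 < a i) (hb : ∀ i, 0 < b i) (c : ℝ)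
    (h : ∑ i, Real.logb 2 (a i / b i) ≤ c) : ∏ i, a i ≤ 2 ^ c * ∏ i, b i := by
  have h1 : ∏ i, (a i / b i) ≤ 2 ^ c := by
    have : (2 : ℝ) ^ (∑ i, Real.logb 2 (a i / b i)) = ∏ i, (a i / b i) := by
      rw [Real.rpow_sum_of_pos (by norm_num)]
      refine Finset.prod_congr rfl fun i _ => ?_
      exact Real.rpow_logb (by norm_num) (by norm_num) (div_pos (ha i) (hb i))
    rw [← this]
    exact Real.rpow_le_rpow_of_exponent_le (by norm_num) h
  rw [Finset.prod_div_distrib] at h1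
  exact (div_le_iff₀ (Finset.prod_pos fun i _ => hb i)).1 h1

lemma good_mass {Ω : Type*} [Fintype Ω] (ρ : Ω → ℝ) (hρ : IsPMF ρ) (b1 b2 b3 b4 : Ω → Prop)
    {_ : DecidablePred b1} {_ : DecidablePred b2} {_ : DecidablePred b3} {_ : DecidablePred b4}
    (S : Ω → Prop) {_ : DecidablePred S}
    (η δ : ℝ) (hδ : 0 ≤ δ) (hδ1 : δ ≤ 1)
    (h1 : ∑ ω, (if b1 ω then ρ ω else 0) ≤ η) (h2 : ∑ ω, (if b2 ω then ρ ω else 0) ≤ η)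
    (h3 : ∑ ω, (if b3 ω then ρ ω else 0) ≤ η) (h4 : ∑ ω, (if b4 ω then ρ ω else 0) ≤ η)
    (hS : ∀ ω, ρ ω ≠ 0 → ¬ b1 ω → ¬ b2 ω → ¬ b3 ω → ¬ b4 ω → S ω) :
    1 - (4 * η + 2 * δ) ≤ ∑ ω, (if S ω then ρ ω else 0) * (1 - δ) ^ 2 := by
  have e : (1 : ℝ) - 2 * δ = ∑ ω, ρ ω * (1 - 2 * δ) := by rw [← Finset.sum_mul, hρ.2, one_mul]
  have key : (1 : ℝ) - 2 * δ - (∑ ω, (if b1 ω then ρ ω else 0)) -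
      (∑ ω, (if b2 ω then ρ ω else 0)) - (∑ ω, (if b3 ω then ρ ω else 0)) -
      (∑ ω, (if b4 ω then ρ ω else 0)) ≤ ∑ ω, (if S ω then ρ ω else 0) * (1 - δ) ^ 2 := by
    rw [e, ← Finset.sum_sub_distrib, ← Finset.sum_sub_distrib, ← Finset.sum_sub_distrib,
      ← Finset.sum_sub_distrib]
    refine Finset.sum_le_sum fun ω _ => ?_
    have h0 := hρ.1 ω
    have hs := hS ω
    have hd1 : ρ ω * (1 - 2 * δ) ≤ ρ ω * (1 - δ) ^ 2 :=
      mul_le_mul_of_nonneg_left (by nlinarith) h0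
    have hd2 : ρ ω * (1 - 2 * δ) ≤ ρ ω := by nlinarith
    have hd3 : 0 ≤ ρ ω * (1 - δ) ^ 2 := by positivity
    by_cases hz : ρ ω = 0
    · simp [hz]
    have n1 : 0 ≤ (if b1 ω then ρ ω else 0) := by split_ifs <;> simp [h0]
    have n2 : 0 ≤ (if b2 ω then ρ ω else 0) := by split_ifs <;> simp [h0]
    have n3 : 0 ≤ (if b3 ω then ρ ω else 0) := by split_ifs <;> simp [h0]
    have n4 : 0 ≤ (if b4 ω then ρ ω else 0) := by split_ifs <;> simp [h0]
    by_cases hs' : S ω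
    · rw [if_pos hs']; linarith
    · rw [if_neg hs', zero_mul]
      by_cases c1 : b1 ω
      · rw [if_pos c1] at *; linarith
      by_cases c2 : b2 ω
      · rw [if_pos c2] at *; linarith
      by_cases c3 : b3 ω
      · rw [if_pos c3] at *; linarith
      by_cases c4 : b4 ω
      · rw [if_pos c4] at *; linarith
      exact absurd (hs hz c1 c2 c3 c4) hs'
  linarith

lemma dist_bound {Ω : Type*} [Fintype Ω] (ρ : Ω → ℝ) (hρ : IsPMF ρ) (S : Ω → Prop)
    {_ : DecidablePred S} (η c K : ℝ) (hc : 0 ≤ c) (hK : 0 ≤ K)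
    (h : 1 - η ≤ ∑ ω, if S ω then ρ ω else 0) (f : Ω → ℝ) (h1 : ∀ ω, S ω → f ω ≤ c)
    (h2 : ∀ ω, f ω ≤ K) : ∑ ω, ρ ω * f ω ≤ c + η * K := by
  have key : ∑ ω, ρ ω * f ω ≤ ∑ ω, (ρ ω * c + K * (ρ ω - if S ω then ρ ω else 0)) := by
    refine Finset.sum_le_sum fun ω _ => ?_
    have h0 := hρ.1 ω
    by_cases hs : S ω
    · rw [if_pos hs]
      have := mul_le_mul_of_nonneg_left (h1 ω hs) h0
      linarith
    · rw [if_neg hs]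
      have := mul_le_mul_of_nonneg_left (h2 ω) h0
      nlinarith
  rw [Finset.sum_add_distrib, ← Finset.sum_mul, ← Finset.mul_sum, Finset.sum_sub_distrib,
    hρ.2] at key
  nlinarith

lemma floor_bound (n : ℕ) (R ε : ℝ) (hR : 0 ≤ R) (hε : 0 < ε) :
    0 < ⌊(2 : ℝ) ^ ((n : ℝ) * (R + ε))⌋₊ ∧
    (⌊(2 : ℝ) ^ ((n : ℝ) * (R + ε))⌋₊ : ℝ) ≤ (2 : ℝ) ^ ((n : ℝ) * (R + ε)) ∧
    (2 : ℝ) ^ ((n : ℝ) * (R + ε / 2)) ≤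
      (2 * (2 : ℝ) ^ (-((n : ℝ) * (ε / 2)))) * ⌊(2 : ℝ) ^ ((n : ℝ) * (R + ε))⌋₊ := by
  have h1 : (1 : ℝ) ≤ (2 : ℝ) ^ ((n : ℝ) * (R + ε)) :=
    Real.one_le_rpow (by norm_num) (by positivity)
  refine ⟨Nat.floor_pos.2 h1, Nat.floor_le (by positivity), ?_⟩
  have h2 := Nat.lt_floor_add_one ((2 : ℝ) ^ ((n : ℝ) * (R + ε)))
  have h3 : (1 : ℝ) ≤ ⌊(2 : ℝ) ^ ((n : ℝ) * (R + ε))⌋₊ := by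
    exact_mod_cast Nat.floor_pos.2 h1
  have h4 : (2 : ℝ) ^ ((n : ℝ) * (R + ε / 2)) =
      (2 : ℝ) ^ (-((n : ℝ) * (ε / 2))) * (2 : ℝ) ^ ((n : ℝ) * (R + ε)) := by
    rw [← Real.rpow_add (by norm_num)]; congr 1; ring
  rw [h4, mul_comm 2, mul_assoc]
  refine mul_le_mul_of_nonneg_left ?_ (by positivity)
  linarith

lemma delta_tendsto (ε : ℝ) (hε : 0 < ε) (η : ℝ) (hη : 0 < η) :
    ∃ N : ℕ, ∀ n ≥ N, 2 * (2 : ℝ) ^ (-((n : ℝ) * (ε / 2))) ≤ η := by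
  have hr1 : (2 : ℝ) ^ (-(ε / 2)) < 1 := Real.rpow_lt_one_of_one_lt_of_neg (by norm_num) (by linarith)
  obtain ⟨N, hN⟩ := ((tendsto_pow_atTop_nhds_zero_of_lt_one (by positivity) hr1).eventually
    (gt_mem_nhds (half_pos hη))).exists_forall_of_atTop
  refine ⟨N, fun n hn => ?_⟩
  have h := hN n hn
  rw [← Real.rpow_natCast, ← Real.rpow_mul (by norm_num)] at h
  have e : -(ε / 2) * (n : ℝ) = -((n : ℝ) * (ε / 2)) := by ring
  rw [e] at h
  linarith

lemma log_nonneg_mean {Ω : Type*} [Fintype Ω] (q : Ω → ℝ) (hq : IsPMF q) (a b : Ω → ℝ)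
    (ha : ∀ ω, q ω ≠ 0 → 0 < a ω) (hb : ∀ ω, q ω ≠ 0 → 0 < b ω)
    (h : ∑ ω, q ω * (b ω / a ω) ≤ 1) : 0 ≤ expect q (fun ω => Real.logb 2 (a ω / b ω)) := by
  have hl : (0 : ℝ) < Real.log 2 := Real.log_pos (by norm_num)
  have key : ∑ ω, q ω * (1 - b ω / a ω) / Real.log 2 ≤ expect q (fun ω => Real.logb 2 (a ω / b ω)) := by
    refine Finset.sum_le_sum fun ω _ => ?_
    by_cases hz : q ω = 0
    · simp [hz]
    have h1 := ha ω hz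
    have h2 := hb ω hz
    rw [mul_div_assoc]
    refine mul_le_mul_of_nonneg_left ?_ (hq.1 ω)
    change _ ≤ Real.log (a ω / b ω) / Real.log 2
    refine div_le_div_of_nonneg_right ?_ hl.le
    have h3 := Real.log_le_sub_one_of_pos (div_pos h2 h1)
    have h4 : Real.log (a ω / b ω) = - Real.log (b ω / a ω) := by
      rw [← Real.log_inv, inv_div]
    linarith
  refine le_trans ?_ key
  rw [← Finset.sum_div]
  refine div_nonneg ?_ hl.le
  simp only [mul_sub, mul_one, Finset.sum_sub_distrib, hq.2]
  linarith

lemma dist_fin {Ω : Type*} [Fintype Ω] {ρ : Ω → ℝ} (hρ : IsPMF ρ) (S : Ω → Prop)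
    {_ : DecidablePred S} (n : ℕ) (hn : (0 : ℝ) < n) (M ε D : ℝ) (hM : 0 < M) (hε : 0 < ε)
    (hD : 0 ≤ D) (η : ℝ) (hη : 0 < η) (hηM : 3 * η * M = ε / 2)
    (h : 1 - 3 * η ≤ ∑ ω, if S ω then ρ ω else 0) (f : Ω → Fin n → ℝ)
    (hf : ∀ ω i, f ω i ≤ M) (hS : ∀ ω, S ω → ∑ i, f ω i ≤ n * (D + ε / 2)) :
    (1 / n : ℝ) * ∑ i, expect ρ (fun ω => f ω i) ≤ D + ε := by
  have h1 := dist_bound ρ hρ S (3 * η) (n * (D + ε / 2)) (n * M) (by positivity) (by positivity)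
    h (fun ω => ∑ i, f ω i) hS (fun ω => by
      refine (Finset.sum_le_sum fun i _ => hf ω i).trans (le_of_eq ?_)
      simp)
  have h2 : ∑ i, expect ρ (fun ω => f ω i) = ∑ ω, ρ ω * ∑ i, f ω i := by
    simp only [expect, Finset.mul_sum]
    rw [Finset.sum_comm]
  rw [h2, one_div, inv_mul_le_iff₀ hn]
  have h3 : 3 * η * (n * M) = n * (ε / 2) := by rw [← hηM]; ring
  rw [h3] at h1
  linarith

set_option maxHeartbeats 400000 in
/-- Block-length `n` coding theorem, with abstract single-letter kernels. -/
lemma nletter {𝒳 𝒴 𝒵 Xh Yh U₁ U₂ : Type*} [Fintype 𝒳] [Fintype 𝒴] [Fintype 𝒵] [Fintype Xh]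
    [Fintype Yh] [Fintype U₁] [Fintype U₂] [Nonempty U₁] [Nonempty U₂] [Nonempty 𝒵]
    (p : 𝒳 × 𝒴 × 𝒵 → ℝ) (hp : IsPMF p)
    (dA : 𝒴 → Yh → ℝ) (dB : 𝒳 → Xh → ℝ)
    (hdA : ∀ y yv, 0 ≤ dA y yv) (hdB : ∀ x xv, 0 ≤ dB x xv)
    (RAR RRB RBR RRA DA DB : ℝ)
    (h0AR : 0 ≤ RAR) (h0RB : 0 ≤ RRB) (h0BR : 0 ≤ RBR) (h0RA : 0 ≤ RRA)
    (q : (𝒳 × 𝒴 × 𝒵) × U₁ × U₂ → ℝ) (hq : IsPMF q)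
    (Q1 : 𝒳 → U₁ → ℝ) (hQ1 : IsSub Q1) (Q2 : 𝒴 × 𝒵 × U₁ → U₂ → ℝ) (hQ2 : IsSub Q2)
    (P1 : 𝒴 × 𝒵 → U₁ → ℝ) (hP1 : IsSub P1) (P2 : 𝒳 × 𝒵 × U₁ → U₂ → ℝ) (hP2 : IsSub P2)
    (R1 : 𝒴 → 𝒳 × 𝒵 → ℝ) (hR1 : IsSub R1) (R2 : 𝒳 → 𝒴 × 𝒵 → ℝ) (hR2 : IsSub R2)
    (hfac : ∀ ω, q ω = p ω.1 * Q1 ω.1.1 ω.2.1 * Q2 (ω.1.2.1, ω.1.2.2, ω.2.1) ω.2.2)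
    (hP1p : ∀ ω, q ω ≠ 0 → 0 < P1 (ω.1.2.1, ω.1.2.2) ω.2.1)
    (hP2p : ∀ ω, q ω ≠ 0 → 0 < P2 (ω.1.1, ω.1.2.2, ω.2.1) ω.2.2)
    (hR1p : ∀ w, p w ≠ 0 → 0 < R1 w.2.1 (w.1, w.2.2))
    (hR2p : ∀ w, p w ≠ 0 → 0 < R2 w.1 (w.2.1, w.2.2))
    (ΨB : 𝒴 → 𝒵 → U₁ → Xh) (ΨA : 𝒳 → 𝒵 → U₁ → U₂ → Yh)
    (hDB : expect q (fun ω => dB ω.1.1 (ΨB ω.1.2.1 ω.1.2.2 ω.2.1)) ≤ DB)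
    (hDA : expect q (fun ω => dA ω.1.2.1 (ΨA ω.1.1 ω.1.2.2 ω.2.1 ω.2.2)) ≤ DA)
    (hAR : expect q (fun ω => Real.logb 2 (Q1 ω.1.1 ω.2.1 / P1 (ω.1.2.1, ω.1.2.2) ω.2.1)) ≤ RAR)
    (hBR : expect q (fun ω => Real.logb 2 (Q2 (ω.1.2.1, ω.1.2.2, ω.2.1) ω.2.2 /
      P2 (ω.1.1, ω.1.2.2, ω.2.1) ω.2.2)) ≤ RBR)
    (hRB : expect p (fun w => Real.logb 2 (1 / R1 w.2.1 (w.1, w.2.2))) ≤ RRB)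
    (hRA : expect p (fun w => Real.logb 2 (1 / R2 w.1 (w.2.1, w.2.2))) ≤ RRA) :
    TCRAchievable p dA dB RAR RRB RBR RRA DA DB := by
  intro ε hε
  have hDB0 : 0 ≤ DB := le_trans (Finset.sum_nonneg fun ω _ => mul_nonneg (hq.1 ω) (hdB _ _)) hDB
  have hDA0 : 0 ≤ DA := le_trans (Finset.sum_nonneg fun ω _ => mul_nonneg (hq.1 ω) (hdA _ _)) hDA
  let M : ℝ := 1 + (∑ x, ∑ xv, dB x xv) + ∑ y, ∑ yv, dA y yv
  have hsB : 0 ≤ ∑ x, ∑ xv, dB x xv :=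
    Finset.sum_nonneg fun x _ => Finset.sum_nonneg fun xv _ => hdB x xv
  have hsA : 0 ≤ ∑ x, ∑ xv, dA x xv :=
    Finset.sum_nonneg fun x _ => Finset.sum_nonneg fun xv _ => hdA x xv
  have hM0 : 0 < M := by simp only [M]; linarith
  have hMB : ∀ x xv, dB x xv ≤ M := by
    intro x xv
    have h1 := Finset.single_le_sum (f := fun x => ∑ xv, dB x xv)
      (fun x _ => Finset.sum_nonneg fun xv _ => hdB x xv) (Finset.mem_univ x)
    have h2 := Finset.single_le_sum (f := fun xv => dB x xv)
      (fun xv _ => hdB x xv) (Finset.mem_univ xv)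
    simp only [M]; linarith
  have hMA : ∀ x xv, dA x xv ≤ M := by
    intro x xv
    have h1 := Finset.single_le_sum (f := fun x => ∑ xv, dA x xv)
      (fun x _ => Finset.sum_nonneg fun xv _ => hdA x xv) (Finset.mem_univ x)
    have h2 := Finset.single_le_sum (f := fun xv => dA x xv)
      (fun xv _ => hdA x xv) (Finset.mem_univ xv)
    simp only [M]; linarith
  have hε2 : 0 < ε / 2 := by linarith
  let η : ℝ := ε / (6 * M)
  have hη : 0 < η := by positivity
  have hηM : 3 * η * M = ε / 2 := by simp only [η]; field_simp; norm_num
  have hη8 : 0 < η / 8 := by positivity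
  obtain ⟨N1, hN1⟩ := lln q hq _ _ hAR (ε / 2) hε2 (η / 8) hη8
  obtain ⟨N2, hN2⟩ := lln q hq _ _ hBR (ε / 2) hε2 (η / 8) hη8
  obtain ⟨N3, hN3⟩ := lln q hq _ _ hDA (ε / 2) hε2 (η / 8) hη8
  obtain ⟨N4, hN4⟩ := lln q hq _ _ hDB (ε / 2) hε2 (η / 8) hη8
  obtain ⟨N5, hN5⟩ := lln p hp _ _ hRB (ε / 2) hε2 (η / 8) hη8
  obtain ⟨N6, hN6⟩ := lln p hp _ _ hRA (ε / 2) hε2 (η / 8) hη8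
  obtain ⟨N7, hN7⟩ := delta_tendsto ε hε (min 1 (η / 8)) (lt_min one_pos hη8)
  refine ⟨N1 + N2 + N3 + N4 + N5 + N6 + N7 + 1, fun n hn => ?_⟩
  replace hN1 := hN1 n (by omega)
  replace hN2 := hN2 n (by omega)
  replace hN3 := hN3 n (by omega)
  replace hN4 := hN4 n (by omega)
  replace hN5 := hN5 n (by omega)
  replace hN6 := hN6 n (by omega)
  replace hN7 := hN7 n (by omega)
  have hn0 : (0 : ℝ) < n := by
    have : 0 < n := by omega
    exact_mod_cast this
  obtain ⟨f1p, f1l, f1g⟩ := floor_bound n RAR ε h0AR hε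
  obtain ⟨f2p, f2l, f2g⟩ := floor_bound n RBR ε h0BR hε
  obtain ⟨f3p, f3l, f3g⟩ := floor_bound n RRB ε h0RB hε
  obtain ⟨f4p, f4l, f4g⟩ := floor_bound n RRA ε h0RA hε
  generalize ⌊(2 : ℝ) ^ ((n : ℝ) * (RAR + ε))⌋₊ = B1 at f1p f1l f1g
  generalize ⌊(2 : ℝ) ^ ((n : ℝ) * (RBR + ε))⌋₊ = B2 at f2p f2l f2g
  generalize ⌊(2 : ℝ) ^ ((n : ℝ) * (RRB + ε))⌋₊ = K1 at f3p f3l f3g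
  generalize ⌊(2 : ℝ) ^ ((n : ℝ) * (RRA + ε))⌋₊ = K2 at f4p f4l f4g
  have hδ0 : 0 ≤ 2 * (2 : ℝ) ^ (-((n : ℝ) * (ε / 2))) := by positivity
  generalize 2 * (2 : ℝ) ^ (-((n : ℝ) * (ε / 2))) = δ at hδ0 hN7 f1g f2g f3g f4g
  have hδ1 : δ ≤ 1 := hN7.trans (min_le_left _ _)
  have hδη : δ ≤ η / 8 := hN7.trans (min_le_right _ _)
  let z : (Fin n → 𝒳 × 𝒴 × 𝒵) → (Fin n → U₁) → (Fin n → U₂) →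
    (Fin n → (𝒳 × 𝒴 × 𝒵) × U₁ × U₂) := fun w u1 u2 i => (w i, u1 i, u2 i)
  obtain ⟨Gs, hGs⟩ : ∃ Gs : (Fin n → (𝒳 × 𝒴 × 𝒵) × U₁ × U₂) → Prop, ∀ v, Gs v ↔ ((∀ i, q (v i) ≠ 0) ∧
    (∑ i, Real.logb 2 (Q1 (v i).1.1 (v i).2.1 / P1 ((v i).1.2.1, (v i).1.2.2) (v i).2.1)
      ≤ n * (RAR + ε / 2)) ∧
    (∑ i, Real.logb 2 (Q2 ((v i).1.2.1, (v i).1.2.2, (v i).2.1) (v i).2.2 /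
      P2 ((v i).1.1, (v i).1.2.2, (v i).2.1) (v i).2.2) ≤ n * (RBR + ε / 2)) ∧
    (∑ i, dA (v i).1.2.1 (ΨA (v i).1.1 (v i).1.2.2 (v i).2.1 (v i).2.2) ≤ n * (DA + ε / 2)) ∧
    (∑ i, dB (v i).1.1 (ΨB (v i).1.2.1 (v i).1.2.2 (v i).2.1) ≤ n * (DB + ε / 2))) := ⟨_, fun _ => Iff.rfl⟩
  have hmassG : 1 - η ≤ ∑ v, (if Gs v then iid q n v else 0) * (1 - δ) ^ 2 := by
    refine le_trans ?_ (good_mass (iid q n) (iid_isPMF q hq n) _ _ _ _ Gs (η / 8) δ hδ0 hδ1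
      hN1 hN2 hN3 hN4
      (fun v h0 h1 h2 h3 h4 => (hGs v).2 ⟨fun i => Finset.prod_ne_zero_iff.1 h0 i (Finset.mem_univ i),
        not_lt.1 h1, not_lt.1 h2, not_lt.1 h3, not_lt.1 h4⟩))
    linarith
  obtain ⟨T1, hT1⟩ : ∃ T1 : (Fin n → 𝒳 × 𝒴 × 𝒵) → Prop, ∀ w, T1 w ↔ ((∀ i, p (w i) ≠ 0) ∧
    ∑ i, Real.logb 2 (1 / R1 (w i).2.1 ((w i).1, (w i).2.2)) ≤ n * (RRB + ε / 2)) := ⟨_, fun _ => Iff.rfl⟩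
  obtain ⟨T2, hT2⟩ : ∃ T2 : (Fin n → 𝒳 × 𝒴 × 𝒵) → Prop, ∀ w, T2 w ↔ ((∀ i, p (w i) ≠ 0) ∧
    ∑ i, Real.logb 2 (1 / R2 (w i).1 ((w i).2.1, (w i).2.2)) ≤ n * (RRA + ε / 2)) := ⟨_, fun _ => Iff.rfl⟩
  have hδsq : (1 - δ) ^ 2 ≤ 1 - δ := by
    clear * - hδ0 hδ1
    nlinarith
  have hpn := iid_isPMF p hp n
  have hmassT1 : 1 - η ≤ ∑ w, (if T1 w then iid p n w else 0) * (1 - δ) := by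
    refine le_trans ?_ ((good_mass (iid p n) hpn _ _ _ _ T1 (η / 8) δ hδ0 hδ1
      hN5 hN5 hN5 hN5
      (fun v h0 h1 _ _ _ => (hT1 v).2 ⟨fun i => Finset.prod_ne_zero_iff.1 h0 i (Finset.mem_univ i),
        not_lt.1 h1⟩)).trans (Finset.sum_le_sum fun w _ => mul_le_mul_of_nonneg_left
          hδsq ?_))
    · linarith
    · split_ifs
      exacts [hpn.1 w, le_rfl]
  have hmassT2 : 1 - η ≤ ∑ w, (if T2 w then iid p n w else 0) * (1 - δ) := by
    refine le_trans ?_ ((good_mass (iid p n) hpn _ _ _ _ T2 (η / 8) δ hδ0 hδ1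
      hN6 hN6 hN6 hN6
      (fun v h0 h1 _ _ _ => (hT2 v).2 ⟨fun i => Finset.prod_ne_zero_iff.1 h0 i (Finset.mem_univ i),
        not_lt.1 h1⟩)).trans (Finset.sum_le_sum fun w _ => mul_le_mul_of_nonneg_left
          hδsq ?_))
    · linarith
    · split_ifs
      exacts [hpn.1 w, le_rfl]
  have hQpos : ∀ ω, q ω ≠ 0 → 0 < Q1 ω.1.1 ω.2.1 ∧ 0 < Q2 (ω.1.2.1, ω.1.2.2, ω.2.1) ω.2.2 := by
    intro ω hω
    rw [hfac] at hω
    have h1 := right_ne_zero_of_mul (left_ne_zero_of_mul hω)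
    have h2 := right_ne_zero_of_mul hω
    exact ⟨lt_of_le_of_ne (hQ1.1 _ _) h1.symm, lt_of_le_of_ne (hQ2.1 _ _) h2.symm⟩
  have hmassG' : 1 - η ≤ ∑ w, ∑ u1, ∑ u2, if Gs (z w u1 u2) then
      iid p n w * (∏ i, Q1 (w i).1 (u1 i)) * (∏ i, Q2 ((w i).2.1, (w i).2.2, u1 i) (u2 i)) *
        (1 - δ) ^ 2 else 0 := by
    refine hmassG.trans (le_of_eq ?_)
    have e := sum_arrow_prod n (fun (w : Fin n → 𝒳 × 𝒴 × 𝒵) (u : Fin n → U₁ × U₂) =>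
      (if Gs (fun i => (w i, u i)) then iid q n (fun i => (w i, u i)) else 0) * (1 - δ) ^ 2)
    refine e.trans (Finset.sum_congr rfl fun w _ => ?_)
    have e2 := sum_arrow_prod n (fun (u1 : Fin n → U₁) (u2 : Fin n → U₂) =>
      (if Gs (z w u1 u2) then iid q n (z w u1 u2) else 0) * (1 - δ) ^ 2)
    refine e2.trans (Finset.sum_congr rfl fun u1 _ => Finset.sum_congr rfl fun u2 _ => ?_)
    rw [ite_mul, zero_mul]
    refine if_congr Iff.rfl ?_ rfl
    congr 1
    simp only [iid, z]
    rw [← Finset.prod_mul_distrib, ← Finset.prod_mul_distrib]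
    exact Finset.prod_congr rfl fun i _ => hfac _
  have hh1 : ∀ w u1 u2, Gs (z w u1 u2) → (∏ i, Q1 (w i).1 (u1 i)) ≤
      δ * B1 * ∏ i, P1 ((w i).2.1, (w i).2.2) (u1 i) := by
    intro w u1 u2 hg
    obtain ⟨h0, h1, -⟩ := (hGs _).1 hg
    have h := prod_le_of_log (fun i => Q1 (w i).1 (u1 i))
      (fun i => P1 ((w i).2.1, (w i).2.2) (u1 i)) (fun i => (hQpos _ (h0 i)).1)
      (fun i => hP1p _ (h0 i)) _ h1
    exact h.trans (mul_le_mul_of_nonneg_right f1g (Finset.prod_nonneg fun i _ => hP1.1 _ _))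
  have hh2 : ∀ w u1 u2, Gs (z w u1 u2) → (∏ i, Q2 ((w i).2.1, (w i).2.2, u1 i) (u2 i)) ≤
      δ * B2 * ∏ i, P2 ((w i).1, (w i).2.2, u1 i) (u2 i) := by
    intro w u1 u2 hg
    obtain ⟨h0, -, h1, -⟩ := (hGs _).1 hg
    have h := prod_le_of_log (fun i => Q2 ((w i).2.1, (w i).2.2, u1 i) (u2 i))
      (fun i => P2 ((w i).1, (w i).2.2, u1 i) (u2 i)) (fun i => (hQpos _ (h0 i)).2)
      (fun i => hP2p _ (h0 i)) _ h1
    exact h.trans (mul_le_mul_of_nonneg_right f2g (Finset.prod_nonneg fun i _ => hP2.1 _ _))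
  have hh3 : ∀ w, T1 w → 1 ≤ δ * K1 * ∏ i, R1 (w i).2.1 ((w i).1, (w i).2.2) := by
    intro w hg
    obtain ⟨h0, h1⟩ := (hT1 _).1 hg
    have h := prod_le_of_log (fun i => 1)
      (fun i => R1 (w i).2.1 ((w i).1, (w i).2.2)) (fun i => one_pos)
      (fun i => hR1p _ (h0 i)) _ h1
    rw [Finset.prod_const_one] at h
    exact h.trans (mul_le_mul_of_nonneg_right f3g (Finset.prod_nonneg fun i _ => hR1.1 _ _))
  have hh4 : ∀ w, T2 w → 1 ≤ δ * K2 * ∏ i, R2 (w i).1 ((w i).2.1, (w i).2.2) := by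
    intro w hg
    obtain ⟨h0, h1⟩ := (hT2 _).1 hg
    have h := prod_le_of_log (fun i => 1)
      (fun i => R2 (w i).1 ((w i).2.1, (w i).2.2)) (fun i => one_pos)
      (fun i => hR2p _ (h0 i)) _ h1
    rw [Finset.prod_const_one] at h
    exact h.trans (mul_le_mul_of_nonneg_right f4g (Finset.prod_nonneg fun i _ => hR2.1 _ _))
  have key := oneshot' (iid p n) hpn
    (fun w i => (w i).1) (fun w i => (w i).2.1) (fun w i => (w i).2.2)
    (fun x u => ∏ i, Q1 (x i) (u i)) (isSub_pow Q1 hQ1 n)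
    (fun (a : (Fin n → 𝒴) × (Fin n → 𝒵) × (Fin n → U₁)) u => ∏ i, Q2 (a.1 i, a.2.1 i, a.2.2 i) (u i))
    (isSub_comp _ (isSub_pow Q2 hQ2 n)
      (fun a : (Fin n → 𝒴) × (Fin n → 𝒵) × (Fin n → U₁) => fun i => (a.1 i, a.2.1 i, a.2.2 i)))
    (fun (a : (Fin n → 𝒴) × (Fin n → 𝒵)) u => ∏ i, P1 (a.1 i, a.2 i) (u i))
    (isSub_comp _ (isSub_pow P1 hP1 n)
      (fun a : (Fin n → 𝒴) × (Fin n → 𝒵) => fun i => (a.1 i, a.2 i)))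
    (fun (a : (Fin n → 𝒳) × (Fin n → 𝒵) × (Fin n → U₁)) u => ∏ i, P2 (a.1 i, a.2.1 i, a.2.2 i) (u i))
    (isSub_comp _ (isSub_pow P2 hP2 n)
      (fun a : (Fin n → 𝒳) × (Fin n → 𝒵) × (Fin n → U₁) => fun i => (a.1 i, a.2.1 i, a.2.2 i)))
    (fun y a => ∏ i, R1 (y i) (a.1 i, a.2 i)) (isSub_pow_prod R1 hR1 n)
    (fun y a => ∏ i, R2 (y i) (a.1 i, a.2 i)) (isSub_pow_prod R2 hR2 n)
    B1 B2 K1 K2 f1p f2p f3p f4p δ hδ0 hδ1 (fun w u1 u2 => Gs (z w u1 u2))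
    hh1 hh2 T1 T2 hh3 hh4
    η
  replace key := key hmassG' hmassT1 hmassT2
  obtain ⟨φAR, φRB, φBR, φRA, decB, decA, S, hS, hmain⟩ := key
  refine ⟨⟨⟨Fin B1⟩, ⟨Fin K1⟩, ⟨Fin B2⟩, ⟨Fin K2⟩, φAR, φRB, φBR, φRA,
    fun x k i => ΨA (x i) ((decA x k).1 i) ((decA x k).2.1 i) ((decA x k).2.2 i),
    fun y k i => ΨB (y i) ((decB y k).1 i) ((decB y k).2 i)⟩, ?_, ?_, ?_, ?_, ?_, ?_⟩
  · exact (le_of_eq (by simp)).trans f1l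
  · exact (le_of_eq (by simp)).trans f3l
  · exact (le_of_eq (by simp)).trans f2l
  · exact (le_of_eq (by simp)).trans f4l
  · refine dist_fin hpn _ n hn0 M ε DA hM0 hε hDA0 η hη hηM hmain _ (fun w i => hMA _ _) ?_
    intro w hw
    obtain ⟨u1, u2, hG, -, hA⟩ := hS w hw
    refine le_trans (le_of_eq ?_) ((hGs _).1 hG).2.2.2.1
    refine Finset.sum_congr rfl fun i _ => ?_
    simp only [TCRCode.Yhat, TCRCode.mRA, TCRCode.mAR, TCRCode.mBR, TCRCode.mRB, hA, z]
  · refine dist_fin hpn _ n hn0 M ε DB hM0 hε hDB0 η hη hηM hmain _ (fun w i => hMB _ _) ?_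
    intro w hw
    obtain ⟨u1, u2, hG, hB, -⟩ := hS w hw
    refine le_trans (le_of_eq ?_) ((hGs _).1 hG).2.2.2.2
    refine Finset.sum_congr rfl fun i _ => ?_
    simp only [TCRCode.Xhat, TCRCode.mAR, TCRCode.mRB, hB, z]

section Single
variable {Ω α β γ : Type*} [Fintype Ω]

lemma probOf_congr (μ : Ω → ℝ) (f : Ω → α) (g : Ω → β) (a : α) (b : β)
    (h : ∀ ω, f ω = a ↔ g ω = b) : probOf μ f a = probOf μ g b := by
  unfold probOf
  exact Finset.sum_congr rfl fun ω _ => if_congr (h ω) rfl rfl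

lemma probOf_nonneg (μ : Ω → ℝ) (hμ : IsPMF μ) (f : Ω → α) (a : α) : 0 ≤ probOf μ f a := by
  refine Finset.sum_nonneg fun ω _ => ?_
  split_ifs
  exacts [hμ.1 ω, le_rfl]

lemma le_probOf (μ : Ω → ℝ) (hμ : IsPMF μ) (f : Ω → α) (ω : Ω) : μ ω ≤ probOf μ f (f ω) := by
  have h := Finset.single_le_sum (f := fun ω' => if f ω' = f ω then μ ω' else 0)
    (fun ω' _ => by
      split_ifs
      exacts [hμ.1 ω', le_rfl]) (Finset.mem_univ ω)
  beta_reduce at h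
  rw [if_pos rfl] at h
  exact h

lemma probOf_pos (μ : Ω → ℝ) (hμ : IsPMF μ) (f : Ω → α) (ω : Ω) (h : μ ω ≠ 0) :
    0 < probOf μ f (f ω) :=
  lt_of_lt_of_le (lt_of_le_of_ne (hμ.1 ω) h.symm) (le_probOf μ hμ f ω)

lemma probOf_inj (μ : Ω → ℝ) (f : Ω → α) (ω : Ω) (hf : ∀ ω', f ω' = f ω → ω' = ω) :
    probOf μ f (f ω) = μ ω := by
  unfold probOf
  rw [Finset.sum_eq_single ω]
  · rw [if_pos rfl]
  · intro b _ hb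
    rw [if_neg]
    exact fun h => hb (hf b h)
  · intro h
    exact absurd (Finset.mem_univ ω) h

lemma sum_probOf_pair [Fintype α] (μ : Ω → ℝ) (f : Ω → α) (g : Ω → β) (b : β) :
    ∑ a, probOf μ (fun ω => (f ω, g ω)) (a, b) = probOf μ g b := by
  unfold probOf
  rw [Finset.sum_comm]
  refine Finset.sum_congr rfl fun ω _ => ?_
  rw [Finset.sum_eq_single (f ω)]
  · by_cases hb : g ω = b <;> simp [hb]
  · intro a _ ha
    rw [if_neg]
    intro h
    exact ha (Prod.ext_iff.1 h).1.symm
  · intro h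
    exact absurd (Finset.mem_univ _) h

/-- Conditional pmf of `f` given `g`. -/
def ker (μ : Ω → ℝ) (f : Ω → α) (g : Ω → β) (b : β) (a : α) : ℝ :=
  probOf μ (fun ω => (f ω, g ω)) (a, b) / probOf μ g b

lemma ker_isSub [Fintype α] (μ : Ω → ℝ) (hμ : IsPMF μ) (f : Ω → α) (g : Ω → β) :
    IsSub (ker μ f g) := by
  refine ⟨fun b a => div_nonneg (probOf_nonneg μ hμ _ _) (probOf_nonneg μ hμ _ _), fun b => ?_⟩
  unfold ker
  rw [← Finset.sum_div, sum_probOf_pair]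
  exact div_self_le_one _

lemma ker_pos (μ : Ω → ℝ) (hμ : IsPMF μ) (f : Ω → α) (g : Ω → β) (ω : Ω) (h : μ ω ≠ 0) :
    0 < ker μ f g (g ω) (f ω) :=
  div_pos (probOf_pos μ hμ (fun ω => (f ω, g ω)) ω h) (probOf_pos μ hμ g ω h)

lemma entropy_eq [Fintype α] (μ : Ω → ℝ) (f : Ω → α) :
    entropy μ f = expect μ (fun ω => - Real.logb 2 (probOf μ f (f ω))) := by
  have h : ∀ a, probOf μ f a * Real.logb 2 (probOf μ f a) =
      ∑ ω, if f ω = a then μ ω * Real.logb 2 (probOf μ f a) else 0 := by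
    intro a
    conv_lhs => rw [probOf, Finset.sum_mul]
    refine Finset.sum_congr rfl fun ω _ => ?_
    rw [ite_mul, zero_mul]
    rfl
  unfold entropy expect
  simp_rw [h]
  rw [Finset.sum_comm]
  simp only [mul_neg, Finset.sum_neg_distrib]
  congr 1
  refine Finset.sum_congr rfl fun ω _ => ?_
  rw [Finset.sum_eq_single (f ω)]
  · rw [if_pos rfl]
  · intro a _ ha
    rw [if_neg ha.symm]
  · intro h
    exact absurd (Finset.mem_univ _) h

lemma expect_congr (μ : Ω → ℝ) (f g : Ω → ℝ) (h : ∀ ω, μ ω ≠ 0 → f ω = g ω) :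
    expect μ f = expect μ g := by
  refine Finset.sum_congr rfl fun ω _ => ?_
  by_cases hz : μ ω = 0
  · simp [hz]
  · rw [h ω hz]

lemma expect_add (μ : Ω → ℝ) (f g : Ω → ℝ) :
    expect μ f + expect μ g = expect μ (fun ω => f ω + g ω) := by
  simp [expect, mul_add, Finset.sum_add_distrib]

lemma expect_sub (μ : Ω → ℝ) (f g : Ω → ℝ) :
    expect μ f - expect μ g = expect μ (fun ω => f ω - g ω) := by
  simp [expect, mul_sub, Finset.sum_sub_distrib]

lemma condEntropy_eq [Fintype α] [Fintype β] (μ : Ω → ℝ) (hμ : IsPMF μ) (f : Ω → α)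
    (g : Ω → β) :
    condEntropy μ f g = expect μ (fun ω => Real.logb 2 (1 / ker μ f g (g ω) (f ω))) := by
  unfold condEntropy
  rw [entropy_eq, entropy_eq, expect_sub]
  refine expect_congr μ _ _ fun ω hω => ?_
  have h1 := probOf_pos μ hμ (fun ω => (f ω, g ω)) ω hω
  have h2 := probOf_pos μ hμ g ω hω
  unfold ker
  beta_reduce at h1 ⊢
  rw [one_div, Real.logb_inv, Real.logb_div h1.ne' h2.ne']
  ring

lemma condMI_eq [Fintype α] [Fintype β] [Fintype γ] (μ : Ω → ℝ) (hμ : IsPMF μ) (f : Ω → α)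
    (g : Ω → β) (h : Ω → γ) (K : Ω → ℝ) (hK0 : ∀ ω, μ ω ≠ 0 → 0 < K ω)
    (hK : ∀ ω, μ ω ≠ 0 → probOf μ (fun ω => ((f ω, g ω), h ω)) ((f ω, g ω), h ω) =
      K ω * probOf μ (fun ω => (f ω, h ω)) (f ω, h ω)) :
    condMI μ f g h = expect μ (fun ω => Real.logb 2 (K ω / ker μ g h (h ω) (g ω))) := by
  unfold condMI
  rw [condEntropy_eq μ hμ f, condEntropy_eq μ hμ g, condEntropy_eq μ hμ, expect_add, expect_sub]
  refine expect_congr μ _ _ fun ω hω => ?_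
  have h1 := probOf_pos μ hμ (fun ω => (f ω, h ω)) ω hω
  have h2 := probOf_pos μ hμ h ω hω
  have h3 := ker_pos μ hμ g h ω hω
  have h4 := hK ω hω
  have h5 := hK0 ω hω
  have e : ker μ (fun ω => (f ω, g ω)) h (h ω) (f ω, g ω) = K ω * ker μ f h (h ω) (f ω) := by
    unfold ker
    rw [h4, mul_div_assoc]
  have h6 := ker_pos μ hμ f h ω hω
  rw [e, one_div, one_div, one_div, Real.logb_inv, Real.logb_inv, Real.logb_inv,
    Real.logb_mul h5.ne' h6.ne', Real.logb_div h5.ne' h3.ne']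
  ring

end Single

lemma sum_three_le {W A B : Type*} [Fintype W] [Fintype A] [Fintype B] (p : W → ℝ) (hp : IsPMF p)
    (F : W → A → ℝ) (hF : IsSub F) (H : W × A → B → ℝ) (hH : IsSub H) :
    ∑ ω : W × A × B, p ω.1 * F ω.1 ω.2.1 * H (ω.1, ω.2.1) ω.2.2 ≤ 1 := by
  rw [Fintype.sum_prod_type, ← hp.2]
  refine Finset.sum_le_sum fun w _ => ?_
  rw [Fintype.sum_prod_type]
  have h1 : ∀ a, ∑ b, p w * F w a * H (w, a) b ≤ p w * F w a := by
    intro a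
    rw [← Finset.mul_sum]
    exact mul_le_of_le_one_right (mul_nonneg (hp.1 w) (hF.1 w a)) (hH.2 _)
  refine (Finset.sum_le_sum fun a _ => h1 a).trans ?_
  rw [← Finset.mul_sum]
  exact mul_le_of_le_one_right (hp.1 w) (hF.2 _)

lemma isSub_le_one {A U : Type*} [Fintype U] {w : A → U → ℝ} (h : IsSub w) (a : A) (u : U) :
    w a u ≤ 1 :=
  (Finset.single_le_sum (fun u _ => h.1 a u) (Finset.mem_univ u)).trans (h.2 a)

lemma div_cancel_aux {a b c d : ℝ} (ha : 0 ≤ a) (hb : 0 ≤ b) (hc : 0 ≤ c) (hd : 0 ≤ d) :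
    a * b * c * (d / b) ≤ a * d * c := by
  rcases hb.eq_or_lt with h | h
  · rw [← h]
    simp only [mul_zero, zero_mul]
    positivity
  · refine le_of_eq ?_
    field_simp

lemma div_cancel_aux' {a b c d : ℝ} (ha : 0 ≤ a) (hb : 0 ≤ b) (hc : 0 ≤ c) (hd : 0 ≤ d) :
    a * b * c * (d / c) ≤ a * b * d := by
  rcases hc.eq_or_lt with h | h
  · rw [← h]
    simp only [mul_zero, zero_mul]
    positivity
  · refine le_of_eq ?_
    field_simp

/-- **Case 2 (large `R_RA`, `R_RB`; interactive inner bound for two cascaded rounds).**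
Suppose `R_RA ≥ H(Y,Z|X)` and `R_RB ≥ H(X,Z|Y)`, and there are finite-valued `U₁, U₂`
jointly distributed with `(X,Y,Z) ~ p` (joint pmf `q` on `(𝒳 × 𝒴 × 𝒵) × U₁ × U₂`)
satisfying the Markov chains `U₁ − X − (Y,Z)` and `U₂ − (Y,Z,U₁) − X`, with decoders
`Ψ_B(Y,Z,U₁)` and `Ψ_A(X,Z,U₁,U₂)` meeting the distortions.  Then any
`R_AR ≥ I(X;U₁|Y,Z)` and `R_BR ≥ I(Y;U₂|X,Z,U₁)` give a tuple
`(R_AR, R_RB, R_BR, R_RA, D_A, D_B)` achievable for two cascaded rounds. -/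
theorem tcr_large_relay_rates
    {𝒳 𝒴 𝒵 Xh Yh : Type*} [Fintype 𝒳] [Fintype 𝒴] [Fintype 𝒵] [Fintype Xh] [Fintype Yh]
    (p : 𝒳 × 𝒴 × 𝒵 → ℝ) (hp : IsPMF p)
    (dA : 𝒴 → Yh → ℝ) (dB : 𝒳 → Xh → ℝ)
    (hdA : ∀ y yv, 0 ≤ dA y yv) (hdB : ∀ x xv, 0 ≤ dB x xv)
    (RAR RRB RBR RRA DA DB : ℝ)
    -- R_RA ≥ H(Y,Z|X) and R_RB ≥ H(X,Z|Y)
    (hRRA : condEntropy p (fun w => (w.2.1, w.2.2)) (fun w => w.1) ≤ RRA)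
    (hRRB : condEntropy p (fun w => (w.1, w.2.2)) (fun w => w.2.1) ≤ RRB)
    (U₁ U₂ : Type*) [Fintype U₁] [Fintype U₂]
    (q : (𝒳 × 𝒴 × 𝒵) × U₁ × U₂ → ℝ) (hq : IsPMF q)
    -- (X,Y,Z) has joint pmf p
    (hmarg : ∀ w, probOf q (fun ω => ω.1) w = p w)
    -- U₁ − X − (Y,Z)
    (hU₁ : MarkovChain q (fun ω => ω.2.1) (fun ω => ω.1.1) (fun ω => (ω.1.2.1, ω.1.2.2)))
    -- U₂ − (Y,Z,U₁) − X
    (hU₂ : MarkovChain q (fun ω => ω.2.2) (fun ω => (ω.1.2.1, ω.1.2.2, ω.2.1))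
      (fun ω => ω.1.1))
    (ΨB : 𝒴 → 𝒵 → U₁ → Xh) (ΨA : 𝒳 → 𝒵 → U₁ → U₂ → Yh)
    (hDB : expect q (fun ω => dB ω.1.1 (ΨB ω.1.2.1 ω.1.2.2 ω.2.1)) ≤ DB)
    (hDA : expect q (fun ω => dA ω.1.2.1 (ΨA ω.1.1 ω.1.2.2 ω.2.1 ω.2.2)) ≤ DA)
    -- R_AR ≥ I(X;U₁|Y,Z)
    (hRAR : condMI q (fun ω => ω.1.1) (fun ω => ω.2.1)
      (fun ω => (ω.1.2.1, ω.1.2.2)) ≤ RAR)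
    -- R_BR ≥ I(Y;U₂|X,Z,U₁)
    (hRBR : condMI q (fun ω => ω.1.2.1) (fun ω => ω.2.2)
      (fun ω => (ω.1.1, ω.1.2.2, ω.2.1)) ≤ RBR) :
    TCRAchievable p dA dB RAR RRB RBR RRA DA DB := by
  have hne : Nonempty ((𝒳 × 𝒴 × 𝒵) × U₁ × U₂) := by
    by_contra h
    rw [not_nonempty_iff] at h
    have h2 := hq.2
    rw [Finset.univ_eq_empty, Finset.sum_empty] at h2
    exact zero_ne_one h2
  obtain ⟨⟨x0, y0, z0⟩, u10, u20⟩ := hne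
  have : Nonempty U₁ := ⟨u10⟩
  have : Nonempty U₂ := ⟨u20⟩
  have : Nonempty 𝒵 := ⟨z0⟩
  have hQ1 := ker_isSub q hq (fun ω => ω.2.1) (fun ω => ω.1.1)
  have hQ2 := ker_isSub q hq (fun ω => ω.2.2) (fun ω => (ω.1.2.1, ω.1.2.2, ω.2.1))
  have hP1 := ker_isSub q hq (fun ω => ω.2.1) (fun ω => (ω.1.2.1, ω.1.2.2))
  have hP2 := ker_isSub q hq (fun ω => ω.2.2) (fun ω => (ω.1.1, ω.1.2.2, ω.2.1))
  have hR1 := ker_isSub p hp (fun w => (w.1, w.2.2)) (fun w => w.2.1)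
  have hR2 := ker_isSub p hp (fun w => (w.2.1, w.2.2)) (fun w => w.1)
  have hP1p := ker_pos q hq (fun ω => ω.2.1) (fun ω => (ω.1.2.1, ω.1.2.2))
  have hP2p := ker_pos q hq (fun ω => ω.2.2) (fun ω => (ω.1.1, ω.1.2.2, ω.2.1))
  have hR1p := ker_pos p hp (fun w => (w.1, w.2.2)) (fun w => w.2.1)
  have hR2p := ker_pos p hp (fun w => (w.2.1, w.2.2)) (fun w => w.1)
  have hQ1p := ker_pos q hq (fun ω => ω.2.1) (fun ω => ω.1.1)
  have hQ2p := ker_pos q hq (fun ω => ω.2.2) (fun ω => (ω.1.2.1, ω.1.2.2, ω.2.1))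
  -- the Markov chains in kernel form
  have hM1 : ∀ ω : (𝒳 × 𝒴 × 𝒵) × U₁ × U₂, probOf q (fun ω => ω.1.1) ω.1.1 ≠ 0 → probOf q (fun ω => (ω.2.1, ω.1.1, (ω.1.2.1, ω.1.2.2)))
      (ω.2.1, ω.1.1, (ω.1.2.1, ω.1.2.2)) = ker q (fun ω => ω.2.1) (fun ω => ω.1.1) ω.1.1 ω.2.1 *
        probOf q (fun ω => (ω.1.1, (ω.1.2.1, ω.1.2.2))) (ω.1.1, (ω.1.2.1, ω.1.2.2)) := by
    intro ω hω
    have h := hU₁ ω.2.1 ω.1.1 (ω.1.2.1, ω.1.2.2)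
    unfold ker
    rw [div_mul_eq_mul_div, eq_div_iff hω]
    exact h
  have hM2 : ∀ ω : (𝒳 × 𝒴 × 𝒵) × U₁ × U₂, probOf q (fun ω => (ω.1.2.1, ω.1.2.2, ω.2.1)) (ω.1.2.1, ω.1.2.2, ω.2.1) ≠ 0 →
      probOf q (fun ω => (ω.2.2, (ω.1.2.1, ω.1.2.2, ω.2.1), ω.1.1))
      (ω.2.2, (ω.1.2.1, ω.1.2.2, ω.2.1), ω.1.1) =
        ker q (fun ω => ω.2.2) (fun ω => (ω.1.2.1, ω.1.2.2, ω.2.1))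
          (ω.1.2.1, ω.1.2.2, ω.2.1) ω.2.2 *
        probOf q (fun ω => ((ω.1.2.1, ω.1.2.2, ω.2.1), ω.1.1))
          ((ω.1.2.1, ω.1.2.2, ω.2.1), ω.1.1) := by
    intro ω hω
    have h := hU₂ ω.2.2 (ω.1.2.1, ω.1.2.2, ω.2.1) ω.1.1
    unfold ker
    rw [div_mul_eq_mul_div, eq_div_iff hω]
    exact h
  have hfac : ∀ ω, q ω = p ω.1 * ker q (fun ω => ω.2.1) (fun ω => ω.1.1) ω.1.1 ω.2.1 *
      ker q (fun ω => ω.2.2) (fun ω => (ω.1.2.1, ω.1.2.2, ω.2.1))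
        (ω.1.2.1, ω.1.2.2, ω.2.1) ω.2.2 := by
    intro ω
    have hz1 := le_probOf q hq (fun ω => ω.1.1) ω
    have hz2 := le_probOf q hq (fun ω => (ω.1.2.1, ω.1.2.2, ω.2.1)) ω
    by_cases c1 : probOf q (fun ω => ω.1.1) ω.1.1 = 0
    · have e : ker q (fun ω => ω.2.1) (fun ω => ω.1.1) ω.1.1 ω.2.1 = 0 := by
        unfold ker
        rw [c1, div_zero]
      rw [e, mul_zero, zero_mul]
      exact le_antisymm (hz1.trans_eq c1) (hq.1 ω)
    by_cases c2 : probOf q (fun ω => (ω.1.2.1, ω.1.2.2, ω.2.1)) (ω.1.2.1, ω.1.2.2, ω.2.1) = 0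
    · have e : ker q (fun ω => ω.2.2) (fun ω => (ω.1.2.1, ω.1.2.2, ω.2.1))
          (ω.1.2.1, ω.1.2.2, ω.2.1) ω.2.2 = 0 := by
        unfold ker
        rw [c2, div_zero]
      rw [e, mul_zero]
      exact le_antisymm (hz2.trans_eq c2) (hq.1 ω)
    have m1 := hM1 ω c1
    have m2 := hM2 ω c2
    have e1 : probOf q (fun ω => (ω.2.2, (ω.1.2.1, ω.1.2.2, ω.2.1), ω.1.1))
        (ω.2.2, (ω.1.2.1, ω.1.2.2, ω.2.1), ω.1.1) = q ω :=
      probOf_inj q (fun ω => (ω.2.2, (ω.1.2.1, ω.1.2.2, ω.2.1), ω.1.1)) ω (by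
        rintro ⟨⟨a, b, c⟩, d, e⟩ h
        obtain ⟨⟨a', b', c'⟩, d', e'⟩ := ω
        simp only [Prod.mk.injEq] at h ⊢
        tauto)
    have e2 : probOf q (fun ω => ((ω.1.2.1, ω.1.2.2, ω.2.1), ω.1.1))
        ((ω.1.2.1, ω.1.2.2, ω.2.1), ω.1.1) =
        probOf q (fun ω => (ω.2.1, ω.1.1, (ω.1.2.1, ω.1.2.2)))
        (ω.2.1, ω.1.1, (ω.1.2.1, ω.1.2.2)) :=
      probOf_congr q _ _ _ _ (fun ω' => by simp only [Prod.mk.injEq]; tauto)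
    have e3 : probOf q (fun ω => (ω.1.1, (ω.1.2.1, ω.1.2.2))) (ω.1.1, (ω.1.2.1, ω.1.2.2)) =
        p ω.1 := by
      rw [← hmarg]
    rw [e1, e2, m1, e3] at m2
    rw [m2]
    ring
  have hIAR := condMI_eq q hq (fun ω => ω.1.1) (fun ω => ω.2.1) (fun ω => (ω.1.2.1, ω.1.2.2))
    (fun ω => ker q (fun ω => ω.2.1) (fun ω => ω.1.1) ω.1.1 ω.2.1) hQ1p (by
      intro ω hω
      refine Eq.trans ?_ (hM1 ω (probOf_pos q hq (fun ω => ω.1.1) ω hω).ne')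
      exact probOf_congr q _ _ _ _ (fun ω' => by simp only [Prod.mk.injEq]; tauto))
  have hIBR := condMI_eq q hq (fun ω => ω.1.2.1) (fun ω => ω.2.2)
    (fun ω => (ω.1.1, ω.1.2.2, ω.2.1))
    (fun ω => ker q (fun ω => ω.2.2) (fun ω => (ω.1.2.1, ω.1.2.2, ω.2.1))
          (ω.1.2.1, ω.1.2.2, ω.2.1) ω.2.2) hQ2p (by
      intro ω hω
      have m := hM2 ω
        (probOf_pos q hq (fun ω => (ω.1.2.1, ω.1.2.2, ω.2.1)) ω hω).ne'
      have e1 : probOf q (fun ω => ((ω.1.2.1, ω.1.2.2, ω.2.1), ω.1.1))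
          ((ω.1.2.1, ω.1.2.2, ω.2.1), ω.1.1) =
          probOf q (fun ω => (ω.1.2.1, (ω.1.1, ω.1.2.2, ω.2.1)))
          (ω.1.2.1, (ω.1.1, ω.1.2.2, ω.2.1)) :=
        probOf_congr q _ _ _ _ (fun ω' => by simp only [Prod.mk.injEq]; tauto)
      rw [e1] at m
      refine Eq.trans ?_ m
      exact probOf_congr q _ _ _ _ (fun ω' => by simp only [Prod.mk.injEq]; tauto))
  have hHRB := condEntropy_eq p hp (fun w => (w.1, w.2.2)) (fun w => w.2.1)
  have hHRA := condEntropy_eq p hp (fun w => (w.2.1, w.2.2)) (fun w => w.1)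
  rw [hIAR] at hRAR
  rw [hIBR] at hRBR
  rw [hHRB] at hRRB
  rw [hHRA] at hRRA
  have n1 : 0 ≤ RRB := by
    refine le_trans (log_nonneg_mean p hp (fun _ => 1) _ (fun _ _ => one_pos) hR1p ?_) hRRB
    refine le_trans (Finset.sum_le_sum fun w _ => ?_) hp.2.le
    rw [div_one]
    exact mul_le_of_le_one_right (hp.1 w) (isSub_le_one hR1 _ _)
  have n2 : 0 ≤ RRA := by
    refine le_trans (log_nonneg_mean p hp (fun _ => 1) _ (fun _ _ => one_pos) hR2p ?_) hRRA
    refine le_trans (Finset.sum_le_sum fun w _ => ?_) hp.2.le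
    rw [div_one]
    exact mul_le_of_le_one_right (hp.1 w) (isSub_le_one hR2 _ _)
  generalize ker q (fun ω => ω.2.1) (fun ω => ω.1.1) = Q1 at *
  generalize ker q (fun ω => ω.2.2) (fun ω => (ω.1.2.1, ω.1.2.2, ω.2.1)) = Q2 at *
  generalize ker q (fun ω => ω.2.1) (fun ω => (ω.1.2.1, ω.1.2.2)) = P1 at *
  generalize ker q (fun ω => ω.2.2) (fun ω => (ω.1.1, ω.1.2.2, ω.2.1)) = P2 at *
  have n3 : 0 ≤ RAR := by
    refine le_trans (log_nonneg_mean q hq _ _ hQ1p hP1p ?_) hRAR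
    refine le_trans (Finset.sum_le_sum fun ω _ => ?_) (sum_three_le p hp _
      (isSub_comp P1 hP1 (fun w : 𝒳 × 𝒴 × 𝒵 => (w.2.1, w.2.2))) _
      (isSub_comp Q2 hQ2 (fun w : (𝒳 × 𝒴 × 𝒵) × U₁ => (w.1.2.1, w.1.2.2, w.2))))
    beta_reduce
    rw [hfac ω]
    exact div_cancel_aux (hp.1 _) (hQ1.1 _ _) (hQ2.1 _ _) (hP1.1 _ _)
  have n4 : 0 ≤ RBR := by
    refine le_trans (log_nonneg_mean q hq _ _ hQ2p hP2p ?_) hRBR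
    refine le_trans (Finset.sum_le_sum fun ω _ => ?_) (sum_three_le p hp _
      (isSub_comp Q1 hQ1 (fun w : 𝒳 × 𝒴 × 𝒵 => w.1)) _
      (isSub_comp P2 hP2 (fun w : (𝒳 × 𝒴 × 𝒵) × U₁ => (w.1.1, w.1.2.2, w.2))))
    beta_reduce
    rw [hfac ω]
    exact div_cancel_aux' (hp.1 _) (hQ1.1 _ _) (hQ2.1 _ _) (hP2.1 _ _)
  exact nletter p hp dA dB hdA hdB RAR RRB RBR RRA DA DB n3 n1 n4 n2 q hq Q1 hQ1 Q2 hQ2 P1 hP1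
    P2 hP2 _ hR1 _ hR2 hfac hP1p hP2p hR1p hR2p ΨB ΨA hDB hDA hRAR hRBR hRRB hRRA

end IRSC
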